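/- Let k be a field of positive characteristic with separable closure k^s ⊂ k̄, and let P be a Severi-Brauer variety of dimension n over k. Then P_{k^s} ≅ P^n_{k^s}; that is, P becomes trivial already over the separable closure of k. -/

import Mathlib

/-!
STATEMENT 6 (Kollár, Corollary 13 / `SB.triv.sc.cor`):

Let `k` be a field of positive characteristic with separable closure `k^s ⊆ k̄`, and let `P`
be a Severi–Brauer variety of dimension `n` over `k`.  Then `P_{k^s} ≅ ℙⁿ_{k^s}`; that is,
`P` becomes trivial already over the separable closure of `k`.

Here `k^s = separableClosure k k̄` is the relative separable closure of `k` inside its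
algebraic closure `k̄`.
-/

noncomputable section
universe u
open AlgebraicGeometry CategoryTheory CategoryTheory.Limits

attribute [local instance] MvPolynomial.gradedAlgebra

/-- Projective `n`-space over `R`, as `Proj R[x_0,…,x_n]`. -/
def ProjectiveSpace (R : Type u) [CommRing R] (n : ℕ) : Scheme.{u} :=
  Proj (MvPolynomial.homogeneousSubmodule (Fin (n + 1)) R)

/-- The structure morphism `ℙⁿ_R ⟶ Spec R`. -/
def ProjectiveSpace.toSpec (R : Type u) [CommRing R] (n : ℕ) :
    ProjectiveSpace R n ⟶ Spec (CommRingCat.of R) :=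
  Proj.toSpecZero _ ≫ Spec.map (CommRingCat.ofHom
    (algebraMap R (MvPolynomial.homogeneousSubmodule (Fin (n + 1)) R 0)))

/-- Base change of an `k`-scheme along a ring homomorphism `k →+* K`. -/
def schemeBaseChange {k K : Type u} [CommRing k] [CommRing K] (f : k →+* K)
    {X : Scheme.{u}} (sX : X ⟶ Spec (CommRingCat.of k)) : Scheme.{u} :=
  pullback sX (Spec.map (CommRingCat.ofHom f))

def schemeBaseChange.toSpec {k K : Type u} [CommRing k] [CommRing K] (f : k →+* K)
    {X : Scheme.{u}} (sX : X ⟶ Spec (CommRingCat.of k)) :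
    schemeBaseChange f sX ⟶ Spec (CommRingCat.of K) :=
  pullback.snd _ _

/-- `P` (with structure morphism `sP`) is a Severi–Brauer variety of dimension `n` over `k`. -/
structure IsSeveriBrauer {k : Type u} [Field k] {P : Scheme.{u}}
    (sP : P ⟶ Spec (CommRingCat.of k)) (n : ℕ) : Prop where
  proper : IsProper sP
  exists_iso : ∃ e : schemeBaseChange (algebraMap k (AlgebraicClosure k)) sP ≅
      ProjectiveSpace (AlgebraicClosure k) n,
    e.hom ≫ ProjectiveSpace.toSpec (AlgebraicClosure k) n =
      schemeBaseChange.toSpec (algebraMap k (AlgebraicClosure k)) sP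

open TensorProduct in
/-- A nonzero standard smooth algebra over a separably closed field has a rational point. -/
theorem Algebra.IsStandardSmooth.exists_algHom_of_isSepClosed {K : Type u} [Field K] [IsSepClosed K]
    [Infinite K] {R : Type u} [CommRing R] [Nontrivial R] [Algebra K R]
    [Algebra.IsStandardSmooth K R] : Nonempty (R →ₐ[K] K) := by
  obtain ⟨n, g, hgC, hg⟩ := RingHom.IsStandardSmooth.exists_etale_mvPolynomial
    (f := algebraMap K R) (by rw [RingHom.isStandardSmooth_algebraMap]; infer_instance)
  algebraize [g]
  have : IsScalarTower K (MvPolynomial (Fin n) K) R := .of_algebraMap_eq' hgC.symm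
  have hopen : IsOpenMap (PrimeSpectrum.comap (algebraMap (MvPolynomial (Fin n) K) R)) :=
    PrimeSpectrum.isOpenMap_comap_of_hasGoingDown_of_finitePresentation
  obtain ⟨q₀⟩ : Nonempty (PrimeSpectrum R) := inferInstance
  obtain ⟨_, ⟨_, ⟨h, rfl⟩, rfl⟩, hh, hsub⟩ :=
    PrimeSpectrum.isBasis_basic_opens.exists_subset_of_mem_open
      (Set.mem_range_self q₀) hopen.isOpen_range
  have h0 : h ≠ 0 := fun h0 ↦ by simp [h0] at hh
  obtain ⟨a, ha⟩ : ∃ a, MvPolynomial.eval a h ≠ 0 := by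
    by_contra! H
    exact h0 (MvPolynomial.funext fun a ↦ by simp [H])
  obtain ⟨q, hq⟩ := hsub (show (⟨RingHom.ker (MvPolynomial.eval a), RingHom.ker_isPrime _⟩ :
    PrimeSpectrum (MvPolynomial (Fin n) K)) ∈ _ from ha)
  let evalAlg : Algebra (MvPolynomial (Fin n) K) K := (MvPolynomial.eval a).toAlgebra
  have hev (s) : algebraMap (MvPolynomial (Fin n) K) K s = MvPolynomial.eval a s := rfl
  have hmem (s : MvPolynomial (Fin n) K) (hs : MvPolynomial.eval a s = 0) :
      algebraMap _ R s ∈ q.asIdeal := by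
    have : s ∈ (PrimeSpectrum.comap (algebraMap (MvPolynomial (Fin n) K) R) q).asIdeal := by
      rw [hq]; exact hs
    exact this
  have hcompat (s : MvPolynomial (Fin n) K) :
      algebraMap (MvPolynomial (Fin n) K) (R ⧸ q.asIdeal) s =
        algebraMap K (R ⧸ q.asIdeal) (MvPolynomial.eval a s) := by
    rw [← sub_eq_zero, IsScalarTower.algebraMap_apply K (MvPolynomial (Fin n) K) (R ⧸ q.asIdeal),
      ← map_sub, IsScalarTower.algebraMap_apply (MvPolynomial (Fin n) K) R (R ⧸ q.asIdeal)]
    exact Ideal.Quotient.eq_zero_iff_mem.mpr (hmem _ (by simp))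
  let m : K →ₐ[MvPolynomial (Fin n) K] R ⧸ q.asIdeal :=
    { algebraMap K (R ⧸ q.asIdeal) with commutes' s := (hcompat s).symm }
  let T := K ⊗[MvPolynomial (Fin n) K] R
  let l : T →ₐ[MvPolynomial (Fin n) K] R ⧸ q.asIdeal :=
    Algebra.TensorProduct.lift m (IsScalarTower.toAlgHom (MvPolynomial (Fin n) K) R (R ⧸ q.asIdeal))
      fun _ _ ↦ mul_comm _ _
  have : Nontrivial T := l.toRingHom.domain_nontrivial
  obtain ⟨x⟩ : Nonempty (PrimeSpectrum T) := inferInstance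
  let e : T →ₐ[K] K :=
    (Pi.evalAlgHom K _ x).comp (Algebra.FormallyEtale.equivPiOfIsSepClosed K T).toAlgHom
  let r : R →+* T := Algebra.TensorProduct.includeRight.toRingHom
  refine ⟨{ e.toRingHom.comp r with commutes' c := ?_ }⟩
  have : r (algebraMap K R c) = algebraMap K T c := by
    rw [IsScalarTower.algebraMap_apply K (MvPolynomial (Fin n) K) R]
    change (1 : K) ⊗ₜ[MvPolynomial (Fin n) K] algebraMap (MvPolynomial (Fin n) K) R _ = c ⊗ₜ[_] 1
    rw [← mul_one (algebraMap (MvPolynomial (Fin n) K) R _), ← Algebra.smul_def,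
      ← TensorProduct.smul_tmul, Algebra.smul_def, hev]
    simp
  exact (congrArg e this).trans (e.commutes c)

/-- A nonempty smooth scheme over a separably closed field has a rational point. -/
theorem AlgebraicGeometry.Smooth.exists_section_of_isSepClosed {K : Type u} [Field K]
    [IsSepClosed K] [Infinite K] {X : Scheme.{u}} (f : X ⟶ Spec (.of K)) [Smooth f] [Nonempty X] :
    ∃ s : Spec (.of K) ⟶ X, s ≫ f = 𝟙 _ := by
  obtain ⟨x⟩ := ‹Nonempty X›
  obtain ⟨U, hU, V, hV, hxV, e, h⟩ := Smooth.exists_isStandardSmooth f x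
  obtain rfl : U = ⊤ := by
    ext y
    simpa [Subsingleton.elim y (f x)] using e hxV
  have : Nonempty V := ⟨⟨x, hxV⟩⟩
  let φ : K →+* Γ(X, V) := ((Scheme.ΓSpecIso (.of K)).inv ≫ f.appLE ⊤ V e).hom
  have hφ : CommRingCat.ofHom φ = (Scheme.ΓSpecIso (.of K)).inv ≫ f.appLE ⊤ V e := rfl
  have hφs : φ.IsStandardSmooth :=
    RingHom.isStandardSmooth_respectsIso.2 _ (Scheme.ΓSpecIso (.of K)).symm.commRingCatIsoToRingEquiv h
  algebraize [φ]
  obtain ⟨s⟩ := Algebra.IsStandardSmooth.exists_algHom_of_isSepClosed (K := K) (R := Γ(X, V))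
  refine ⟨Spec.map (CommRingCat.ofHom s.toRingHom) ≫ hV.fromSpec, ?_⟩
  have h1 : hV.fromSpec ≫ f = Spec.map (CommRingCat.ofHom φ) := by
    have h2 := (isAffineOpen_top (Spec (.of K))).SpecMap_appLE_fromSpec f hV e
    rw [← h2, hφ, Spec.map_comp, IsAffineOpen.fromSpec_top, Scheme.isoSpec_Spec_inv]
  have h3 : s.toRingHom.comp φ = RingHom.id K := s.comp_algebraMap
  rw [Category.assoc, h1, ← Spec.map_comp, ← CommRingCat.ofHom_comp, h3]
  exact Spec.map_id _

namespace AlgebraicGeometry.Proj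
open HomogeneousLocalization

variable {σ τ A B S S' : Type u} [CommRing A] [SetLike σ A] [AddSubgroupClass σ A]
  {𝒜 : ℕ → σ} [GradedRing 𝒜] [CommRing B] [SetLike τ B] [AddSubgroupClass τ B]
  {ℬ : ℕ → τ} [GradedRing ℬ] [CommRing S] [CommRing S']

variable (𝒜) in
/-- Evaluation of a degree zero fraction with denominator a power of `s` along a ring
homomorphism inverting `s`. -/
def awayEval (φ : A →+* S) (s : A) (hu : IsUnit (φ s)) : Away 𝒜 s →+* S :=
  (Localization.awayLift φ s hu).comp (algebraMap (Away 𝒜 s) (Localization.Away s))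

lemma awayEval_mk (φ : A →+* S) {s : A} (hu : IsUnit (φ s)) {m : ℕ} (hs : s ∈ 𝒜 m) (k : ℕ) (a : A)
    (ha : a ∈ 𝒜 (k • m)) : awayEval 𝒜 φ s hu (.mk 𝒜 hs k a ha) * φ s ^ k = φ a := by
  change Localization.awayLift φ s hu (Localization.mk a ⟨s ^ k, _⟩) * _ = _
  rw [← map_pow, ← IsLocalization.Away.lift_eq (S := Localization.Away s) s hu (s ^ k),
    ← IsLocalization.Away.lift_eq (S := Localization.Away s) s hu a]
  simp only [Localization.awayLift]
  rw [← map_mul, Localization.mk_eq_mk']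
  congr 1
  exact IsLocalization.mk'_spec _ a (⟨s ^ k, ⟨k, rfl⟩⟩ : Submonoid.powers s)

lemma awayEval_eq_of_forall (φ : A →+* S) {s : A} (hu : IsUnit (φ s)) {m : ℕ} (hs : s ∈ 𝒜 m)
    (g : Away 𝒜 s →+* S) (hg : ∀ k a ha, g (.mk 𝒜 hs k a ha) * φ s ^ k = φ a) :
    g = awayEval 𝒜 φ s hu := by
  ext x
  obtain ⟨k, a, ha, rfl⟩ := Away.mk_surjective 𝒜 hs x
  rw [← (hu.pow k).mul_left_inj, hg, awayEval_mk]

variable (𝒜) in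
/-- The `S`-point of `Proj 𝒜` attached to a ring homomorphism `A →+* S` which is invertible on a
homogeneous element of positive degree. -/
def point (φ : A →+* S) {s : A} {m : ℕ} (hs : s ∈ 𝒜 m) (hm : 0 < m) (hu : IsUnit (φ s)) :
    Spec (.of S) ⟶ Proj 𝒜 :=
  Spec.map (CommRingCat.ofHom (awayEval 𝒜 φ s hu)) ≫ awayι 𝒜 s hs hm

lemma SpecMap_comp_point (φ : A →+* S) {s : A} {m : ℕ} (hs : s ∈ 𝒜 m) (hm : 0 < m)
    (hu : IsUnit (φ s)) (g : S →+* S') :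
    Spec.map (CommRingCat.ofHom g) ≫ point 𝒜 φ hs hm hu =
      point 𝒜 (g.comp φ) hs hm (hu.map g) := by
  rw [point, point, ← Category.assoc, ← Spec.map_comp, ← CommRingCat.ofHom_comp]
  congr 3
  refine awayEval_eq_of_forall _ _ hs _ fun k a ha ↦ ?_
  rw [RingHom.comp_apply, RingHom.comp_apply, ← map_pow, ← map_mul, awayEval_mk,
    RingHom.comp_apply]

lemma point_eq_point_mul (φ : A →+* S) {s t x : A} {m l : ℕ} (hs : s ∈ 𝒜 m) (hm : 0 < m)
    (hu : IsUnit (φ s)) (ht : t ∈ 𝒜 l) (hut : IsUnit (φ t)) (hx : x = s * t) :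
    point 𝒜 φ hs hm hu = point 𝒜 φ (s := x) (hx ▸ SetLike.mul_mem_graded hs ht)
      (hm.trans_le (m.le_add_right l)) (by rw [hx, map_mul]; exact hu.mul hut) := by
  rw [point, point, ← SpecMap_awayMap_awayι 𝒜 hs hm ht hx, ← Category.assoc, ← Spec.map_comp,
    ← CommRingCat.ofHom_comp]
  congr 3
  symm
  refine awayEval_eq_of_forall _ _ hs _ fun k a ha ↦ ?_
  have hφ : φ x = φ s * φ t := by rw [hx, map_mul]
  rw [RingHom.comp_apply, awayMap_mk, ← (hut.pow k).mul_left_inj, mul_assoc, ← mul_pow]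
  refine (congrArg (fun z ↦ _ * z ^ k) hφ.symm).trans ?_
  rw [awayEval_mk, map_mul, map_pow]

lemma point_eq_point (φ : A →+* S) {s t : A} {m l : ℕ} (hs : s ∈ 𝒜 m) (hm : 0 < m)
    (hu : IsUnit (φ s)) (ht : t ∈ 𝒜 l) (hl : 0 < l) (hut : IsUnit (φ t)) :
    point 𝒜 φ hs hm hu = point 𝒜 φ ht hl hut := by
  exact (point_eq_point_mul φ hs hm hu ht hut rfl).trans
    (point_eq_point_mul φ ht hl hut hs hu (mul_comm s t)).symm

lemma point_comp_map (f : 𝒜 →+*ᵍ ℬ) (hf) (φ : B →+* S) {s : A} {m : ℕ} (hs : s ∈ 𝒜 m)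
    (hm : 0 < m) (hu : IsUnit (φ (f s))) :
    point ℬ φ (s := f s) (f.2 hs) hm hu ≫ map f hf =
      point 𝒜 (φ.comp f.toRingHom) hs hm hu := by
  rw [point, point, Category.assoc, awayι_comp_map f hf hm s hs, ← Category.assoc,
    ← Spec.map_comp, ← CommRingCat.ofHom_comp]
  congr 3
  refine awayEval_eq_of_forall _ _ hs _ fun k a ha ↦ ?_
  rw [RingHom.comp_apply, Away.map_mk]
  exact awayEval_mk φ hu (f.2 hs) k (f a) _

lemma point_toSpecZero (φ : A →+* S) {s : A} {m : ℕ} (hs : s ∈ 𝒜 m) (hm : 0 < m)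
    (hu : IsUnit (φ s)) : point 𝒜 φ hs hm hu ≫ toSpecZero 𝒜 =
      Spec.map (CommRingCat.ofHom (φ.comp (SetLike.GradeZero.subring 𝒜).subtype)) := by
  rw [point, Category.assoc, awayι_toSpecZero, ← Spec.map_comp, ← CommRingCat.ofHom_comp]
  congr 2
  ext c
  have h : fromZeroRingHom 𝒜 (.powers s) c =
      Away.mk 𝒜 hs 0 c.1 ((zero_smul ℕ m).symm ▸ c.2) := by
    ext
    rw [Away.val_mk]
    change Localization.mk c.1 ⟨1, _⟩ = _
    congr 2
    exact (pow_zero s).symm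
  rw [RingHom.comp_apply, h]
  exact (by simpa using awayEval_mk (𝒜 := 𝒜) φ hu hs 0 c.1 ((zero_smul ℕ m).symm ▸ c.2) :
    awayEval 𝒜 φ s hu _ = φ c.1)

lemma point_eq_of_scale {φ ψ : A →+* S} (u : S) (h : ∀ d, ∀ a ∈ 𝒜 d, φ a = u ^ d * ψ a)
    {s : A} {m : ℕ} (hs : s ∈ 𝒜 m) (hm : 0 < m) (hu : IsUnit (φ s)) (hu' : IsUnit (ψ s)) :
    point 𝒜 φ hs hm hu = point 𝒜 ψ hs hm hu' := by
  rw [point, point]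
  congr 3
  refine awayEval_eq_of_forall _ _ hs _ fun k a ha ↦ ?_
  have h1 := awayEval_mk (𝒜 := 𝒜) φ hu hs k a ha
  have hum : IsUnit (u ^ m) := isUnit_of_mul_isUnit_left (h m s hs ▸ hu)
  rw [h _ a ha, h _ s hs, mul_pow, smul_eq_mul, mul_comm k, pow_mul] at h1
  rw [← (hum.pow k).mul_right_inj, ← h1]
  ring

/-- Two ring homomorphisms defining the same point are proportional. -/
lemma proportional_of_point_eq {φ ψ : A →+* S} {s t : A} (hs : s ∈ 𝒜 1) (ht : t ∈ 𝒜 1)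
    (hu : IsUnit (φ s)) (hu' : IsUnit (ψ t))
    (h : point 𝒜 φ hs one_pos hu = point 𝒜 ψ ht one_pos hu') {d : ℕ} {x y : A}
    (hx : x ∈ 𝒜 d) (hy : y ∈ 𝒜 d) : φ x * ψ y = φ y * ψ x := by
  have h' : Spec.map (CommRingCat.ofHom (awayEval 𝒜 φ s hu)) ≫ awayι 𝒜 s hs one_pos =
    Spec.map (CommRingCat.ofHom (awayEval 𝒜 ψ t hu')) ≫ awayι 𝒜 t ht one_pos := h
  obtain ⟨c, hc⟩ := Spec.map_surjective (pullback.lift _ _ h' ≫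
    (pullbackAwayιIso 𝒜 hs one_pos ht one_pos (x := s * t) rfl).hom)
  have h1 : c.hom.comp (awayMap 𝒜 ht rfl) = awayEval 𝒜 φ s hu := by
    have := congr($hc ≫ Spec.map (CommRingCat.ofHom (awayMap 𝒜 ht rfl)))
    rw [Category.assoc, pullbackAwayιIso_hom_SpecMap_awayMap_left, pullback.lift_fst,
      ← Spec.map_comp] at this
    exact congr(CommRingCat.Hom.hom $(Spec.map_injective this))
  have h2 : c.hom.comp (awayMap 𝒜 hs (mul_comm s t)) = awayEval 𝒜 ψ t hu' := by
    have := congr($hc ≫ Spec.map (CommRingCat.ofHom (awayMap 𝒜 hs (mul_comm s t))))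
    rw [Category.assoc, pullbackAwayιIso_hom_SpecMap_awayMap_right, pullback.lift_snd,
      ← Spec.map_comp] at this
    exact congr(CommRingCat.Hom.hom $(Spec.map_injective this))
  have hx' : x ∈ 𝒜 (d • 1) := by simpa using hx
  have hy' : y ∈ 𝒜 (d • 1) := by simpa using hy
  rw [← awayEval_mk φ hu hs d x hx', ← awayEval_mk φ hu hs d y hy', ← awayEval_mk ψ hu' ht d x hx',
    ← awayEval_mk ψ hu' ht d y hy', ← h1, ← h2, RingHom.comp_apply, RingHom.comp_apply,
    RingHom.comp_apply, RingHom.comp_apply, awayMap_mk, awayMap_mk, awayMap_mk, awayMap_mk]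
  suffices key : Away.mk 𝒜 (SetLike.mul_mem_graded hs ht) d (x * t ^ d) (by
        rw [smul_add]; exact SetLike.mul_mem_graded hx' (SetLike.pow_mem_graded d ht)) *
      Away.mk 𝒜 (SetLike.mul_mem_graded hs ht) d (y * s ^ d) (by
        rw [smul_add]; exact SetLike.mul_mem_graded hy' (SetLike.pow_mem_graded d hs)) =
      Away.mk 𝒜 (SetLike.mul_mem_graded hs ht) d (y * t ^ d) (by
        rw [smul_add]; exact SetLike.mul_mem_graded hy' (SetLike.pow_mem_graded d ht)) *
      Away.mk 𝒜 (SetLike.mul_mem_graded hs ht) d (x * s ^ d) (by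
        rw [smul_add]; exact SetLike.mul_mem_graded hx' (SetLike.pow_mem_graded d hs)) by
    have := congr(c.hom $key)
    rw [map_mul, map_mul] at this
    linear_combination (φ s ^ d * ψ t ^ d) * this
  ext
  simp only [val_mul, Away.val_mk, Localization.mk_mul]
  congr 1
  ring

end AlgebraicGeometry.Proj

namespace MvPolynomial

variable {σ R S : Type*} [CommRing R] [CommRing S]

lemma IsHomogeneous.map_eq_pow_mul {φ ψ : MvPolynomial σ R →+* S} {u : S}
    (hC : ∀ r, φ (C r) = ψ (C r)) (hX : ∀ i, φ (X i) = u * ψ (X i)) {p : MvPolynomial σ R} {d : ℕ}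
    (hp : p.IsHomogeneous d) : φ p = u ^ d * ψ p := by
  rw [p.as_sum, map_sum, map_sum, Finset.mul_sum]
  refine Finset.sum_congr rfl fun m hm ↦ ?_
  rw [monomial_eq, map_mul, map_mul, hC, Finsupp.prod, map_prod, map_prod]
  simp_rw [map_pow, hX, mul_pow]
  rw [Finset.prod_mul_distrib, Finset.prod_pow_eq_pow_sum]
  have := hp (mem_support_iff.mp hm)
  rw [Finsupp.weight_apply, Finsupp.sum] at this
  simp only [Pi.one_apply, smul_eq_mul, mul_one] at this
  rw [this]
  ring

variable (R) in
/-- Setting the `i`-th homogeneous coordinate equal to `1`. -/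
def dehomogenize {n : ℕ} (i : Fin (n + 1)) :
    MvPolynomial (Fin (n + 1)) R →+* MvPolynomial (Fin n) R :=
  eval₂Hom C (i.insertNth 1 X)

section dehomogenize
variable {n : ℕ} (i : Fin (n + 1))

@[simp] lemma dehomogenize_C (r : R) : dehomogenize R i (C r) = C r := by simp [dehomogenize]

@[simp] lemma dehomogenize_X_self : dehomogenize R i (X i) = 1 := by simp [dehomogenize]

@[simp] lemma dehomogenize_X_succAbove (k : Fin n) :
    dehomogenize R i (X (i.succAbove k)) = X k := by simp [dehomogenize]

variable {i} in
/-- Dehomogenization is injective on homogeneous polynomials. -/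
lemma IsHomogeneous.eq_zero_of_dehomogenize_eq_zero {p : MvPolynomial (Fin (n + 1)) R} {d : ℕ}
    (hp : p.IsHomogeneous d) (h : dehomogenize R i p = 0) : p = 0 := by
  let L := Localization.Away (X i : MvPolynomial (Fin (n + 1)) R)
  have hinj : Function.Injective (algebraMap (MvPolynomial (Fin (n + 1)) R) L) :=
    IsLocalization.injective L
      (M := Submonoid.powers (X i : MvPolynomial (Fin (n + 1)) R))
      (Submonoid.powers_le.mpr isRegular_X.mem_nonZeroDivisors)
  apply hinj
  obtain ⟨v, hv⟩ := (IsLocalization.Away.algebraMap_isUnit (S := L)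
    (X i : MvPolynomial (Fin (n + 1)) R)).exists_right_inv
  let g : MvPolynomial (Fin n) R →+* L :=
    eval₂Hom ((algebraMap (MvPolynomial (Fin (n + 1)) R) L).comp C)
      fun k ↦ algebraMap (MvPolynomial (Fin (n + 1)) R) L (X (i.succAbove k)) * v
  rw [hp.map_eq_pow_mul (φ := algebraMap _ L) (ψ := g.comp (dehomogenize R i))
    (u := algebraMap (MvPolynomial (Fin (n + 1)) R) L (X i)) (fun r ↦ by simp [g]) fun j ↦ ?_]
  · simp [h]
  · induction j using i.succAboveCases with
    | x => simp
    | p k =>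
      simp only [RingHom.comp_apply, dehomogenize_X_succAbove, g, coe_eval₂Hom, eval₂_X]
      linear_combination (-algebraMap (MvPolynomial (Fin (n + 1)) R) L (X (i.succAbove k))) * hv

end dehomogenize

end MvPolynomial

namespace ProjectiveSpace
open MvPolynomial HomogeneousLocalization

variable {R S S' : Type u} [CommRing R] [CommRing S] [CommRing S'] {n : ℕ}

lemma X_mem (i : Fin (n + 1)) : (X i : MvPolynomial (Fin (n + 1)) R) ∈
    homogeneousSubmodule (Fin (n + 1)) R 1 :=
  isHomogeneous_X R i

/-- The point of projective space with homogeneous coordinates `φ (X j)`. -/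
def point (φ : MvPolynomial (Fin (n + 1)) R →+* S) (i : Fin (n + 1)) (hu : IsUnit (φ (X i))) :
    Spec (.of S) ⟶ ProjectiveSpace R n :=
  Proj.point (homogeneousSubmodule (Fin (n + 1)) R) φ (X_mem i) one_pos hu

lemma point_congr {φ φ' : MvPolynomial (Fin (n + 1)) R →+* S} (h : φ = φ') (i : Fin (n + 1))
    (hu : IsUnit (φ (X i))) : point φ i hu = point φ' i (h ▸ hu) := by
  subst h; rfl

lemma point_eq_point (φ : MvPolynomial (Fin (n + 1)) R →+* S) (i j : Fin (n + 1))
    (hu : IsUnit (φ (X i))) (hu' : IsUnit (φ (X j))) : point φ i hu = point φ j hu' :=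
  Proj.point_eq_point ..

lemma SpecMap_comp_point (φ : MvPolynomial (Fin (n + 1)) R →+* S) (i : Fin (n + 1))
    (hu : IsUnit (φ (X i))) (g : S →+* S') :
    Spec.map (CommRingCat.ofHom g) ≫ point φ i hu = point (g.comp φ) i (hu.map g) :=
  Proj.SpecMap_comp_point ..

lemma point_toSpec (φ : MvPolynomial (Fin (n + 1)) R →+* S) (i : Fin (n + 1))
    (hu : IsUnit (φ (X i))) :
    point φ i hu ≫ toSpec R n = Spec.map (CommRingCat.ofHom (φ.comp C)) := by
  have := Proj.point_toSpecZero (𝒜 := homogeneousSubmodule (Fin (n + 1)) R) φ (X_mem i) one_pos hu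
  refine (Category.assoc _ _ _).symm.trans (congr($this ≫ Spec.map (CommRingCat.ofHom
    (algebraMap R (homogeneousSubmodule (Fin (n + 1)) R 0)))).trans ?_)
  exact (Spec.map_comp _ _).symm

lemma point_eq_of_scale {φ ψ : MvPolynomial (Fin (n + 1)) R →+* S} (u : S)
    (hC : ∀ r, φ (C r) = ψ (C r)) (hX : ∀ i, φ (X i) = u * ψ (X i)) (i : Fin (n + 1))
    (hu : IsUnit (φ (X i))) (hu' : IsUnit (ψ (X i))) : point φ i hu = point ψ i hu' :=
  Proj.point_eq_of_scale u (fun _ _ ha ↦ IsHomogeneous.map_eq_pow_mul hC hX ha) ..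

lemma proportional_of_point_eq {φ ψ : MvPolynomial (Fin (n + 1)) R →+* S} {i j : Fin (n + 1)}
    {hu : IsUnit (φ (X i))} {hu' : IsUnit (ψ (X j))} (h : point φ i hu = point ψ j hu')
    (k l : Fin (n + 1)) : φ (X k) * ψ (X l) = φ (X l) * ψ (X k) :=
  Proj.proportional_of_point_eq (X_mem i) (X_mem j) hu hu' h (X_mem k) (X_mem l)

variable (R) in
/-- The standard affine chart. -/
def chart (i : Fin (n + 1)) : Spec (.of (MvPolynomial (Fin n) R)) ⟶ ProjectiveSpace R n :=
  point (dehomogenize R i) i (by simp)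

lemma bijective_awayEval_dehomogenize (i : Fin (n + 1)) : Function.Bijective
    (Proj.awayEval (homogeneousSubmodule (Fin (n + 1)) R) (dehomogenize R i) (X i) (by simp)) := by
  have hmk := Proj.awayEval_mk (𝒜 := homogeneousSubmodule (Fin (n + 1)) R) (dehomogenize R i)
    (s := X i) (by simp) (X_mem i)
  simp only [dehomogenize_X_self, one_pow, mul_one] at hmk
  refine ⟨(injective_iff_map_eq_zero _).mpr fun x hx ↦ ?_, fun p ↦ ?_⟩
  · obtain ⟨k, a, ha, rfl⟩ := Away.mk_surjective _ (X_mem i) x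
    rw [hmk] at hx
    ext
    have ha0 : a = 0 := IsHomogeneous.eq_zero_of_dehomogenize_eq_zero ha hx
    rw [Away.val_mk, ha0, Localization.mk_zero, val_zero]
  · induction p using MvPolynomial.induction_on with
    | C r => exact ⟨.mk _ (X_mem i) 0 (C r) (by simp), by simp [hmk]⟩
    | add p q hp hq =>
      obtain ⟨⟨x, rfl⟩, ⟨y, rfl⟩⟩ := And.intro hp hq
      exact ⟨x + y, map_add ..⟩
    | mul_X p k hp =>
      obtain ⟨x, rfl⟩ := hp
      refine ⟨x * .mk _ (X_mem i) 1 (X (i.succAbove k)) (by simpa using isHomogeneous_X _ _), ?_⟩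
      rw [map_mul, hmk, dehomogenize_X_succAbove]

instance (i : Fin (n + 1)) : IsOpenImmersion (chart R i) := by
  have : IsIso (CommRingCat.ofHom (Proj.awayEval (homogeneousSubmodule (Fin (n + 1)) R)
      (dehomogenize R i) (X i) (by simp))) :=
    (RingEquiv.ofBijective _ (bijective_awayEval_dehomogenize i)).toCommRingCatIso.isIso_hom
  exact inferInstanceAs (IsOpenImmersion (_ ≫ Proj.awayι _ _ (X_mem i) one_pos))

lemma opensRange_chart (i : Fin (n + 1)) :
    (chart R i).opensRange = Proj.basicOpen (homogeneousSubmodule (Fin (n + 1)) R) (X i) := by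
  have : IsIso (CommRingCat.ofHom (Proj.awayEval (homogeneousSubmodule (Fin (n + 1)) R)
      (dehomogenize R i) (X i) (by simp))) :=
    (RingEquiv.ofBijective _ (bijective_awayEval_dehomogenize i)).toCommRingCatIso.isIso_hom
  rw [← Proj.opensRange_awayι _ _ (X_mem i) one_pos]
  exact Scheme.Hom.opensRange_comp_of_isIso _
    (Proj.awayι (homogeneousSubmodule (Fin (n + 1)) R) (X i) (X_mem i) one_pos)

lemma chart_toSpec (i : Fin (n + 1)) :
    chart R i ≫ toSpec R n = Spec.map (CommRingCat.ofHom C) := by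
  rw [chart, point_toSpec]
  congr 2
  ext r
  simp

lemma irrelevant_le_span_X : (HomogeneousIdeal.irrelevant
    (homogeneousSubmodule (Fin (n + 1)) R)).toIdeal ≤ Ideal.span (Set.range X) := by
  rw [HomogeneousIdeal.toIdeal_irrelevant_le]
  intro d hd p hp
  rw [← Set.image_univ]
  refine mem_ideal_span_X_image.mpr ?_
  intro m hm
  by_contra! H
  have h0 : m = 0 := by ext j; simpa using H j
  have := (show p.IsHomogeneous d from hp) (mem_support_iff.mp hm)
  rw [h0, map_zero] at this
  exact hd.ne this

lemma iSup_opensRange_chart : ⨆ i, (chart R (n := n) i).opensRange = ⊤ := by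
  simp_rw [opensRange_chart]
  exact Proj.iSup_basicOpen_eq_top _ _ irrelevant_le_span_X

variable (n R) in
/-- The standard affine cover of projective space. -/
def affineOpenCover : (ProjectiveSpace R n).AffineOpenCover where
  I₀ := Fin (n + 1)
  X _ := .of (MvPolynomial (Fin n) R)
  f i := chart R i
  idx x := (TopologicalSpace.Opens.mem_iSup.mp
    (iSup_opensRange_chart.ge (Set.mem_univ x))).choose
  covers x := (TopologicalSpace.Opens.mem_iSup.mp
    (iSup_opensRange_chart.ge (Set.mem_univ x))).choose_spec

lemma hom_ext {Z : Scheme.{u}} {f g : ProjectiveSpace R n ⟶ Z}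
    (h : ∀ i, chart R i ≫ f = chart R i ≫ g) : f = g :=
  (affineOpenCover R n).openCover.hom_ext _ _ h

/-- A point in the `i`-th chart, in affine coordinates. -/
lemma SpecMap_comp_chart (i : Fin (n + 1)) (g : MvPolynomial (Fin n) R →+* S) :
    Spec.map (CommRingCat.ofHom g) ≫ chart R i =
      point (g.comp (dehomogenize R i)) i (by simp) :=
  SpecMap_comp_point ..

lemma point_eq_SpecMap_comp_chart (φ : MvPolynomial (Fin (n + 1)) R →+* S) (i : Fin (n + 1))
    (v : S) (hv : φ (X i) * v = 1) : point φ i (.of_mul_eq_one _ hv) =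
    Spec.map (CommRingCat.ofHom (eval₂Hom (φ.comp C) fun k ↦ φ (X (i.succAbove k)) * v)) ≫
      chart R i := by
  rw [SpecMap_comp_chart]
  refine point_eq_of_scale (φ (X i)) (fun r ↦ by simp) (fun j ↦ ?_) _ _ _
  induction j using i.succAboveCases with
  | x => simp
  | p k =>
    simp only [RingHom.comp_apply, dehomogenize_X_succAbove, coe_eval₂Hom, eval₂_X]
    linear_combination (-φ (X (i.succAbove k))) * hv

end ProjectiveSpace

namespace ProjectiveSpace
open MvPolynomial

variable {R S T : Type u} [CommRing R] [CommRing S] [CommRing T] {n : ℕ}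

/-- A ring homomorphism between polynomial rings in the same number of variables which preserves
degrees and does not kill all coordinates. -/
structure IsProjective (g : MvPolynomial (Fin (n + 1)) R →+* MvPolynomial (Fin (n + 1)) S) :
    Prop where
  isHomogeneous {d : ℕ} {p : MvPolynomial (Fin (n + 1)) R} : p.IsHomogeneous d →
    (g p).IsHomogeneous d
  X_mem_span (j : Fin (n + 1)) : X j ∈ Ideal.span (Set.range fun i ↦ g (X i))

namespace IsProjective

/-- The graded ring homomorphism underlying a projective one. -/
def gradedRingHom {g : MvPolynomial (Fin (n + 1)) R →+* MvPolynomial (Fin (n + 1)) S}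
    (hg : IsProjective g) : GradedRingHom (homogeneousSubmodule (Fin (n + 1)) R)
      (homogeneousSubmodule (Fin (n + 1)) S) where
  __ := g
  map_mem hx := hg.isHomogeneous hx

lemma irrelevant_le {g : MvPolynomial (Fin (n + 1)) R →+* MvPolynomial (Fin (n + 1)) S}
    (hg : IsProjective g) : HomogeneousIdeal.irrelevant (homogeneousSubmodule (Fin (n + 1)) S) ≤
      (HomogeneousIdeal.irrelevant (homogeneousSubmodule (Fin (n + 1)) R)).map
        hg.gradedRingHom := by
  rw [← toIdeal_le_toIdeal_iff, HomogeneousIdeal.toIdeal_map]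
  refine irrelevant_le_span_X.trans (Ideal.span_le.mpr ?_)
  rintro _ ⟨j, rfl⟩
  refine Ideal.span_mono ?_ (hg.X_mem_span j)
  rintro _ ⟨i, rfl⟩
  exact ⟨X i, HomogeneousIdeal.mem_irrelevant_of_mem _ one_pos (X_mem i), rfl⟩

/-- The morphism of projective spaces induced by a projective ring homomorphism. -/
def toHom {g : MvPolynomial (Fin (n + 1)) R →+* MvPolynomial (Fin (n + 1)) S}
    (hg : IsProjective g) : ProjectiveSpace S n ⟶ ProjectiveSpace R n :=
  Proj.map hg.gradedRingHom hg.irrelevant_le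

variable {g : MvPolynomial (Fin (n + 1)) R →+* MvPolynomial (Fin (n + 1)) S} (hg : IsProjective g)

lemma point_toHom (φ : MvPolynomial (Fin (n + 1)) S →+* T) (i j : Fin (n + 1))
    (hu : IsUnit (φ (X i))) (hu' : IsUnit (φ (g (X j)))) :
    point φ i hu ≫ hg.toHom = point (φ.comp g) j hu' := by
  have h1 := Proj.point_eq_point (𝒜 := homogeneousSubmodule (Fin (n + 1)) S) φ
    (X_mem i) one_pos hu (hg.isHomogeneous (X_mem j)) one_pos hu'
  have h2 := Proj.point_comp_map hg.gradedRingHom hg.irrelevant_le φ (X_mem j) one_pos hu'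
  exact congr($h1 ≫ _).trans h2

lemma comp {g' : MvPolynomial (Fin (n + 1)) S →+* MvPolynomial (Fin (n + 1)) T}
    (hg' : IsProjective g') (hg : IsProjective g) : IsProjective (g'.comp g) where
  isHomogeneous h := hg'.isHomogeneous (hg.isHomogeneous h)
  X_mem_span j := by
    have h (k) : g' (X k) ∈ Ideal.span (Set.range fun i ↦ g' (g (X i))) := by
      have := Ideal.mem_map_of_mem g' (hg.X_mem_span k)
      rwa [Ideal.map_span, ← Set.range_comp] at this
    refine Ideal.span_le.mpr ?_ (hg'.X_mem_span j)
    rintro _ ⟨k, rfl⟩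
    exact h k

lemma id : IsProjective (RingHom.id (MvPolynomial (Fin (n + 1)) R)) where
  isHomogeneous h := h
  X_mem_span j := Ideal.subset_span ⟨j, rfl⟩

lemma toHom_comp {g' : MvPolynomial (Fin (n + 1)) S →+* MvPolynomial (Fin (n + 1)) T}
    (hg' : IsProjective g') (hg : IsProjective g) :
    (hg'.comp hg).toHom = hg'.toHom ≫ hg.toHom :=
  Proj.map_comp _ _ hg.irrelevant_le hg'.irrelevant_le

lemma toHom_id : (id (R := R) (n := n)).toHom = 𝟙 _ :=
  Proj.map_id

lemma toHom_congr {g g' : MvPolynomial (Fin (n + 1)) R →+* MvPolynomial (Fin (n + 1)) S}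
    (hg : IsProjective g) (h : g = g') : hg.toHom = (h ▸ hg : IsProjective g').toHom := by
  subst h; rfl

lemma map (f : R →+* S) : IsProjective (n := n) (MvPolynomial.map f) where
  isHomogeneous h := h.map f
  X_mem_span j := Ideal.subset_span ⟨j, by simp⟩

end IsProjective

/-- The morphism `ℙⁿ_S ⟶ ℙⁿ_R` induced by `R →+* S`. -/
def baseMap (f : R →+* S) (n : ℕ) : ProjectiveSpace S n ⟶ ProjectiveSpace R n :=
  (IsProjective.map f).toHom

lemma baseMap_comp (f : R →+* S) (g : S →+* T) :
    baseMap (g.comp f) n = baseMap g n ≫ baseMap f n := by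
  rw [baseMap, baseMap, baseMap, ← IsProjective.toHom_comp]
  exact IsProjective.toHom_congr _ (RingHom.ext fun p ↦ (MvPolynomial.map_map f g p).symm)

lemma baseMap_id : baseMap (RingHom.id R) n = 𝟙 _ := by
  rw [baseMap, ← IsProjective.toHom_id]
  exact IsProjective.toHom_congr _ (RingHom.ext MvPolynomial.map_id)

lemma point_baseMap (f : R →+* S) (φ : MvPolynomial (Fin (n + 1)) S →+* T) (i : Fin (n + 1))
    (hu : IsUnit (φ (X i))) : point φ i hu ≫ baseMap f n =
      point (φ.comp (MvPolynomial.map f)) i (by simpa using hu) :=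
  IsProjective.point_toHom _ _ _ _ hu _

lemma chart_baseMap (f : R →+* S) (i : Fin (n + 1)) :
    chart S i ≫ baseMap f n = Spec.map (CommRingCat.ofHom (MvPolynomial.map f)) ≫ chart R i := by
  rw [chart, point_baseMap, SpecMap_comp_chart]
  refine point_congr ?_ _ _
  ext j
  · simp
  · induction j using i.succAboveCases <;> simp

lemma isPullback_chart_baseMap (f : R →+* S) (i : Fin (n + 1)) :
    IsPullback (Spec.map (CommRingCat.ofHom (MvPolynomial.map f))) (chart S i) (chart R i)
      (baseMap f n) := by
  refine IsOpenImmersion.isPullback _ _ _ _ (chart_baseMap f i) ?_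
  rw [opensRange_chart, opensRange_chart]
  refine (Proj.map_preimage_basicOpen _ _ _).trans ?_
  congr 1
  exact map_X f i

attribute [local instance] MvPolynomial.algebraMvPolynomial in
/-- Projective space commutes with base change. -/
lemma isPullback_baseMap (f : R →+* S) (n : ℕ) :
    IsPullback (baseMap f n) (toSpec S n) (toSpec R n) (Spec.map (CommRingCat.ofHom f)) := by
  refine Scheme.isPullback_of_openCover _ _ _ _ (affineOpenCover R n).openCover
    fun (i : Fin (n + 1)) ↦ ?_
  algebraize [f]
  have h : IsPullback (Spec.map (CommRingCat.ofHom (MvPolynomial.map f)))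
      (Spec.map (CommRingCat.ofHom C)) (Spec.map (CommRingCat.ofHom C))
      (Spec.map (CommRingCat.ofHom f)) :=
    (isPullback_SpecMap_of_isPushout _ _ _ _ (CommRingCat.isPushout_of_isPushout R S
      (MvPolynomial (Fin n) R) (MvPolynomial (Fin n) S))).flip
  refine h.of_iso (isPullback_chart_baseMap f i).flip.isoPullback
    (.refl _) (.refl _) (.refl _) ?_ ?_ ?_ ?_
  · exact (Category.comp_id _).trans (IsPullback.isoPullback_hom_snd _).symm
  · exact (Category.comp_id _).trans ((chart_toSpec i).symm.trans
      (congr($((IsPullback.isoPullback_hom_fst (isPullback_chart_baseMap f i).flip).symm) ≫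
        toSpec S n).trans (Category.assoc _ _ _)))
  · exact (Category.comp_id _).trans ((chart_toSpec i).symm.trans (Category.id_comp _).symm)
  · simp

end ProjectiveSpace

namespace MvPolynomial

variable {ι A : Type*} [CommRing A]

lemma _root_.Finsupp.exists_eq_add_single {m : ι →₀ ℕ} (hm : m ≠ 0) :
    ∃ k m', m = m' + Finsupp.single k 1 := by
  obtain ⟨k, hk⟩ := Finsupp.ne_iff.mp hm
  exact ⟨k, m - Finsupp.single k 1, (tsub_add_cancel_of_le
    (Finsupp.single_le_iff.mpr (Nat.one_le_iff_ne_zero.mpr hk))).symm⟩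

lemma coeff_eq_zero_of_totalDegree_lt_degree {p : MvPolynomial ι A} {m : ι →₀ ℕ}
    (h : p.totalDegree < m.degree) : coeff m p = 0 :=
  coeff_eq_zero_of_totalDegree_lt h

lemma coeff_eq_zero_of_totalDegree_X_pow_mul_le {N d : ℕ} {i : ι} {p : MvPolynomial ι A}
    (h : (X i ^ N * p).totalDegree ≤ N + d) {m : ι →₀ ℕ} (hm : d < m.degree) : coeff m p = 0 := by
  have : coeff (Finsupp.single i N + m) (X i ^ N * p) = 0 := by
    apply coeff_eq_zero_of_totalDegree_lt_degree
    rw [map_add, Finsupp.degree_single]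
    lia
  rwa [X_pow_eq_monomial, coeff_monomial_mul, one_mul] at this

lemma eq_C_add_sum_of_coeff_eq_zero [Fintype ι] {p : MvPolynomial ι A}
    (h : ∀ m : ι →₀ ℕ, 1 < m.degree → coeff m p = 0) :
    p = C (coeff 0 p) + ∑ k, C (coeff (Finsupp.single k 1) p) * X k := by
  classical
  ext m
  simp only [coeff_add, coeff_C, coeff_sum, coeff_C_mul, coeff_X]
  by_cases hm : m = 0
  · subst hm
    simp
  obtain ⟨k, m, rfl⟩ := Finsupp.exists_eq_add_single hm
  by_cases hm' : m = 0
  · subst hm'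
    simp [Finsupp.single_left_inj, eq_comm (a := (0 : ι →₀ ℕ))]
  · have h2 : ∀ x, Finsupp.single x 1 ≠ m + Finsupp.single k 1 := fun x hx ↦ by
      have := congr(Finsupp.degree $hx)
      simp only [map_add, Finsupp.degree_single] at this
      exact hm' (Finsupp.degree_eq_zero_iff m |>.mp (by lia))
    rw [h, if_neg (Ne.symm hm)]
    · simp [h2]
    · rw [map_add, Finsupp.degree_single]
      have := mt (Finsupp.degree_eq_zero_iff m).mp hm'
      lia

/-- Vector fields of degree at most two on affine space which are regular at infinity. -/
lemma exists_eq_of_totalDegree_le_two [Fintype ι] {δ : ι → MvPolynomial ι A}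
    (h : ∀ i (m : ι →₀ ℕ), 2 < m.degree → coeff m (δ i) = 0)
    (h' : ∀ i j, (X i * δ j - X j * δ i).totalDegree ≤ 2) :
    ∃ (c : ι → A) (L : ι → ι → A) (l : ι → A), ∀ i,
      δ i = C (c i) + ∑ k, C (L i k) * X k + X i * ∑ k, C (l k) * X k := by
  classical
  let l (k : ι) : A := coeff (Finsupp.single k 1 + Finsupp.single k 1) (δ k)
  have key (i : ι) (m : ι →₀ ℕ) (hm : 1 < m.degree) :
      coeff m (δ i - X i * ∑ k, C (l k) * X k) = 0 := by
    have hS (k) (m : ι →₀ ℕ) : coeff (m + Finsupp.single k 1) (∑ k, C (l k) * X k) =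
        if m = 0 then l k else 0 := by
      simp only [coeff_sum, coeff_C_mul, coeff_X]
      split_ifs with hm
      · subst hm
        simp [Finsupp.single_left_inj]
      · refine Finset.sum_eq_zero fun x _ ↦ ?_
        rw [if_neg, mul_zero]
        intro hx
        have := congr(Finsupp.degree $hx)
        simp only [map_add, Finsupp.degree_single] at this
        exact hm (Finsupp.degree_eq_zero_iff m |>.mp (by lia))
    have hd : m ≠ 0 := by rintro rfl; simp at hm
    by_cases hi : i ∈ m.support
    · obtain ⟨m, rfl⟩ : ∃ m', m = m' + Finsupp.single i 1 :=
        ⟨m - Finsupp.single i 1, (tsub_add_cancel_of_le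
          (Finsupp.single_le_iff.mpr (Nat.one_le_iff_ne_zero.mpr
            (Finsupp.mem_support_iff.mp hi)))).symm⟩
      have hm0 : m ≠ 0 := by rintro rfl; simp at hm
      obtain ⟨k, m, rfl⟩ := Finsupp.exists_eq_add_single hm0
      rw [coeff_sub, mul_comm (X i), coeff_mul_X, hS, sub_eq_zero]
      by_cases h0 : m = 0
      · subst h0
        have := coeff_eq_zero_of_totalDegree_lt_degree (p := X i * δ k - X k * δ i)
          (m := Finsupp.single k 1 + Finsupp.single k 1 + Finsupp.single i 1) (by
            simp only [map_add, Finsupp.degree_single]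
            have := h' i k
            lia)
        rw [coeff_sub, mul_comm, coeff_mul_X, add_right_comm, mul_comm (X k), coeff_mul_X,
          sub_eq_zero] at this
        rw [if_pos rfl, zero_add]
        exact this.symm
      · rw [if_neg h0]
        apply h
        simp only [map_add, Finsupp.degree_single]
        have := mt (Finsupp.degree_eq_zero_iff m).mp h0
        lia
    · rw [coeff_sub, coeff_X_mul', if_neg hi, sub_zero]
      obtain ⟨k, m, rfl⟩ := Finsupp.exists_eq_add_single hd
      have := coeff_eq_zero_of_totalDegree_lt_degree (p := X i * δ k - X k * δ i)
          (m := m + Finsupp.single k 1 + Finsupp.single k 1) (by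
            simp only [map_add, Finsupp.degree_single] at hm ⊢
            have := h' i k
            lia)
      rw [coeff_sub, coeff_X_mul', if_neg, mul_comm (X k), coeff_mul_X, zero_sub,
        neg_eq_zero] at this
      · exact this
      · simp only [Finsupp.mem_support_iff, Finsupp.coe_add, Pi.add_apply, ne_eq,
          Nat.add_eq_zero_iff, not_and, not_forall, not_not] at hi ⊢
        tauto
  exact ⟨_, _, l, fun i ↦ sub_eq_iff_eq_add.mp (eq_C_add_sum_of_coeff_eq_zero (key i))⟩

/-- A vector field on projective space vanishing on a projective frame is trivial. -/
lemma eq_zero_of_totalDegree_le_two [Fintype ι] [DecidableEq ι] {δ : ι → MvPolynomial ι A}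
    (h : ∀ i (m : ι →₀ ℕ), 2 < m.degree → coeff m (δ i) = 0)
    (h' : ∀ i j, (X i * δ j - X j * δ i).totalDegree ≤ 2) {τ : ι → A} (hτ : ∀ i, IsUnit (τ i))
    (hτ' : IsUnit (1 - ∑ i, τ i)) (h0 : ∀ i, eval 0 (δ i) = 0)
    (h1 : ∀ i k, eval (Pi.single k 1) (δ i) = 0) (h2 : ∀ i, eval τ (δ i) = 0) : δ = 0 := by
  obtain ⟨c, L, l, H⟩ := exists_eq_of_totalDegree_le_two h h'
  have hc (i) : c i = 0 := by simpa [H] using h0 i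
  have hL (i k) : L i k = - if i = k then l k else 0 := by
    have := h1 i k
    simp only [H, hc, map_add, map_sum, map_mul, eval_C, eval_X, Pi.single_apply, mul_ite, mul_one,
      mul_zero, zero_add, Finset.sum_ite_eq', Finset.mem_univ, if_true, ite_mul, one_mul,
      zero_mul] at this
    exact eq_neg_of_add_eq_zero_left this
  have hl (i) : l i = ∑ k, l k * τ k := by
    have := h2 i
    simp only [H, hc, hL, map_add, map_sum, map_mul, eval_C, eval_X, neg_mul, map_neg,
      Finset.sum_neg_distrib, ite_mul, zero_mul, Finset.sum_ite_eq, Finset.mem_univ, if_true,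
      zero_add] at this
    rw [mul_comm, neg_add_eq_zero] at this
    exact (hτ i).mul_left_cancel this
  have hl0 : ∑ k, l k * τ k = 0 := by
    refine hτ'.mul_left_cancel ?_
    rw [mul_zero, sub_mul, one_mul, sub_eq_zero, Finset.sum_mul]
    exact Finset.sum_congr rfl fun i _ ↦ by rw [← hl, mul_comm]
  have hl' (i) : l i = 0 := (hl i).trans hl0
  ext1 i
  simp [H, hc, hL, hl']

lemma totalDegree_X_pow_le (i : ι) (N : ℕ) : (X i ^ N : MvPolynomial ι A).totalDegree ≤ N := by
  cases subsingleton_or_nontrivial A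
  · simp [Subsingleton.elim (X i ^ N : MvPolynomial ι A) 0]
  · simp

lemma totalDegree_mul_X_pow_le {p : MvPolynomial ι A} {N : ℕ} (hp : p.totalDegree ≤ N) (i : ι)
    (d : ℕ) : (p * X i ^ d).totalDegree ≤ N + d :=
  (totalDegree_mul _ _).trans (add_le_add hp (totalDegree_X_pow_le i d))

/-- An endomorphism of projective space fixing a projective frame is trivial to first order. -/
lemma eq_zero_of_mul_eq_zero_of_frame [Fintype ι] [DecidableEq ι] {δ : ι → MvPolynomial ι A}
    (hδ : ∀ i j, δ i * δ j = 0)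
    (h : ∀ i, ∃ N H, totalDegree H ≤ N ∧ H * (X i + δ i) = X i ^ N)
    (h' : ∀ i j, ∃ N H, totalDegree H ≤ N ∧ H * (X i + δ i) = X i ^ N * (X j + δ j))
    {τ : ι → A} (hτ : ∀ i, IsUnit (τ i))
    (hτ' : IsUnit (1 - ∑ i, τ i)) (h0 : ∀ i, eval 0 (δ i) = 0)
    (h1 : ∀ i k, eval (Pi.single k 1) (δ i) = 0) (h2 : ∀ i, eval τ (δ i) = 0) : δ = 0 := by
  have hd (i) (m : ι →₀ ℕ) (hm : 2 < m.degree) : coeff m (δ i) = 0 := by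
    obtain ⟨N, H, hN, hH⟩ := h i
    refine coeff_eq_zero_of_totalDegree_X_pow_mul_le (N := N) (i := i) (d := 2) ?_ hm
    have : X i ^ N * δ i = X i ^ (N + 1) - H * X i ^ 2 := by
      linear_combination (X i - δ i) * hH + H * hδ i i
    rw [this]
    refine (totalDegree_sub _ _).trans (max_le ?_ (totalDegree_mul_X_pow_le hN i 2))
    exact (totalDegree_X_pow_le i _).trans (by lia)
  refine eq_zero_of_totalDegree_le_two hd (fun i j ↦ ?_) hτ hτ' h0 h1 h2
  obtain ⟨N, H, hN, hH⟩ := h' i j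
  have key : X i ^ N * (X i * δ j - X j * δ i) = H * X i ^ 2 - X i ^ N * X j * X i := by
    linear_combination (δ i - X i) * hH - H * hδ i i + X i ^ N * hδ i j
  refine Finset.sup_le fun m hm ↦ not_lt.mp fun hm' ↦ mem_support_iff.mp hm ?_
  refine coeff_eq_zero_of_totalDegree_X_pow_mul_le (N := N) (i := i) (d := 2) ?_ hm'
  rw [key]
  refine (totalDegree_sub _ _).trans (max_le (totalDegree_mul_X_pow_le hN i 2) ?_)
  simpa using totalDegree_mul_X_pow_le
    (totalDegree_mul_X_pow_le (totalDegree_X_pow_le (A := A) i N) j 1) i 1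

/-- An infinitesimal endomorphism of projective space fixing a projective frame is trivial. -/
lemma eq_X_of_frame [Fintype ι] [DecidableEq ι] {f : ι → MvPolynomial ι A}
    (hf : ∀ i m, IsNilpotent (coeff m (f i - X i)))
    (h : ∀ i, ∃ N H, totalDegree H ≤ N ∧ H * f i = X i ^ N)
    (h' : ∀ i j, ∃ N H, totalDegree H ≤ N ∧ H * f i = X i ^ N * f j)
    {τ : ι → A} (hτ : ∀ i, IsUnit (τ i))
    (hτ' : IsUnit (1 - ∑ i, τ i)) (h0 : ∀ i, eval 0 (f i) = 0)
    (h1 : ∀ i k, eval (Pi.single k 1) (f i) = Pi.single (M := fun _ ↦ A) k 1 i)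
    (h2 : ∀ i, eval τ (f i) = τ i) (i : ι) : f i = X i := by
  let δ (i : ι) : MvPolynomial ι A := f i - X i
  let s : Set A := ⋃ i, (δ i).coeffs
  have hs : s.Finite := Set.finite_iUnion fun i ↦ Finset.finite_toSet _
  let I : Ideal A := Ideal.span s
  have hmem (i m) : coeff m (δ i) ∈ I := by
    by_cases hm : coeff m (δ i) = 0
    · exact hm ▸ I.zero_mem
    · exact Ideal.subset_span (Set.mem_iUnion.mpr ⟨i, coeff_mem_coeffs m hm⟩)
  have hnil : I ≤ nilradical A := by
    refine Ideal.span_le.mpr (Set.iUnion_subset fun i ↦ ?_)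
    intro a ha
    obtain ⟨m, -, rfl⟩ := mem_coeffs_iff.mp ha
    exact hf i m
  let q := Ideal.Quotient.mk (I * I)
  have hq : (fun i ↦ map q (δ i)) = 0 := by
    have e (i) : X i + map q (δ i) = map q (f i) := by simp [δ]
    have ev (v : ι → A) (i) (hv : eval v (f i) = v i) (w : ι → A ⧸ I * I) (hw : q ∘ v = w) :
        eval w (map q (δ i)) = 0 := by
      rw [← hw, ← map_eval, map_sub, eval_X, hv, sub_self, map_zero]
    refine eq_zero_of_mul_eq_zero_of_frame (τ := fun i ↦ q (τ i)) (fun i j ↦ ?_) (fun i ↦ ?_)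
      (fun i j ↦ ?_) (fun i ↦ (hτ i).map q) ?_ (fun i ↦ ?_) (fun i k ↦ ?_) (fun i ↦ ?_)
    · rw [← map_mul]
      ext m
      rw [coeff_map, coeff_zero]
      refine Ideal.Quotient.eq_zero_iff_mem.mpr ?_
      rw [coeff_mul]
      exact Ideal.sum_mem _ fun x _ ↦ Ideal.mul_mem_mul (hmem _ _) (hmem _ _)
    · obtain ⟨N, H, hN, hH⟩ := h i
      exact ⟨N, map q H, (Finset.sup_mono (support_map_subset q H)).trans hN, by
        rw [e, ← map_mul, hH, map_pow, map_X]⟩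
    · obtain ⟨N, H, hN, hH⟩ := h' i j
      exact ⟨N, map q H, (Finset.sup_mono (support_map_subset q H)).trans hN, by
        rw [e, e, ← map_mul, hH, map_mul, map_pow, map_X]⟩
    · simpa using hτ'.map q
    · exact ev 0 i (h0 i) _ (by ext; simp)
    · exact ev (Pi.single k 1) i (h1 i k) _ (by ext; simp [Pi.single_apply, apply_ite q])
    · exact ev τ i (h2 i) _ rfl
  have hI : I = ⊥ := by
    refine Submodule.eq_bot_of_le_smul_of_le_jacobson_bot I I ⟨hs.toFinset, by simp [I]⟩ ?_
      (hnil.trans (Ideal.radical_le_jacobson))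
    refine Ideal.span_le.mpr (Set.iUnion_subset fun i ↦ ?_)
    intro a ha
    obtain ⟨m, -, rfl⟩ := mem_coeffs_iff.mp ha
    have := congr(coeff m ($hq i))
    rw [coeff_map, Pi.zero_apply, coeff_zero] at this
    exact Ideal.Quotient.eq_zero_iff_mem.mp this
  refine sub_eq_zero.mp (MvPolynomial.ext _ _ fun m ↦ ?_)
  have := hmem i m
  rwa [hI] at this

end MvPolynomial

namespace ProjectiveSpace
open MvPolynomial

variable {K A B : Type u} [CommRing K] [CommRing A] [CommRing B] {n : ℕ}

lemma dehomogenize_X_mem_nonZeroDivisors (i j : Fin (n + 1)) :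
    dehomogenize A i (X j) ∈ nonZeroDivisors (MvPolynomial (Fin n) A) := by
  induction j using i.succAboveCases with
  | x => simp
  | p k => simpa using isRegular_X.mem_nonZeroDivisors

lemma totalDegree_dehomogenize_X_le (i j : Fin (n + 1)) :
    (dehomogenize A i (X j)).totalDegree ≤ 1 := by
  induction j using i.succAboveCases with
  | x => simp
  | p k => simpa using totalDegree_X_pow_le (A := A) k 1

/-- Change of charts, after restriction to the generic points. -/
lemma exists_transition {T : Type u} [CommRing T] [Algebra (MvPolynomial (Fin n) A) T]
    [IsLocalization (nonZeroDivisors (MvPolynomial (Fin n) A)) T] (i j : Fin (n + 1)) :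
    ∃ χ : MvPolynomial (Fin n) A →+* T,
      (∀ a, χ (C a) = algebraMap (MvPolynomial (Fin n) A) T (C a)) ∧
      (∀ l, algebraMap (MvPolynomial (Fin n) A) T (dehomogenize A i (X j)) *
        χ (dehomogenize A j (X l)) = algebraMap _ T (dehomogenize A i (X l))) ∧
      Spec.map (CommRingCat.ofHom (algebraMap (MvPolynomial (Fin n) A) T)) ≫ chart A i =
        Spec.map (CommRingCat.ofHom χ) ≫ chart A j := by
  obtain ⟨v, hv⟩ := (IsLocalization.map_units T
    ⟨_, dehomogenize_X_mem_nonZeroDivisors (A := A) i j⟩).exists_right_inv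
  let φ := (algebraMap (MvPolynomial (Fin n) A) T).comp (dehomogenize A i)
  refine ⟨eval₂Hom (φ.comp C) fun k ↦ φ (X (j.succAbove k)) * v, fun a ↦ by simp [φ], fun l ↦ ?_, ?_⟩
  · induction l using j.succAboveCases with
    | x => simp
    | p k =>
      rw [dehomogenize_X_succAbove, coe_eval₂Hom, eval₂_X]
      linear_combination φ (X (j.succAbove k)) * hv
  · rw [SpecMap_comp_chart, ← point_eq_SpecMap_comp_chart φ j v hv]
    exact point_eq_point _ _ _ _ _

lemma exists_mul_pow_eq {T : Type u} [CommRing T] [Algebra (MvPolynomial (Fin n) A) T]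
    {i j : Fin (n + 1)} {χ : MvPolynomial (Fin n) A →+* T}
    (hC : ∀ a, χ (C a) = algebraMap (MvPolynomial (Fin n) A) T (C a))
    (hX : ∀ l, algebraMap (MvPolynomial (Fin n) A) T (dehomogenize A i (X j)) *
        χ (dehomogenize A j (X l)) = algebraMap _ T (dehomogenize A i (X l)))
    (g : MvPolynomial (Fin n) A) : ∃ N H, totalDegree H ≤ N ∧
      χ g * algebraMap (MvPolynomial (Fin n) A) T (dehomogenize A i (X j)) ^ N =
        algebraMap (MvPolynomial (Fin n) A) T H := by
  induction g using MvPolynomial.induction_on with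
  | C a => exact ⟨0, C a, by simp, by simp [hC]⟩
  | add p q hp hq =>
    obtain ⟨N, H, hN, hH⟩ := hp
    obtain ⟨N', H', hN', hH'⟩ := hq
    refine ⟨N + N', H * dehomogenize A i (X j) ^ N' + H' * dehomogenize A i (X j) ^ N, ?_, ?_⟩
    · have h (M) : (dehomogenize A i (X j) ^ M).totalDegree ≤ M :=
        (totalDegree_pow _ _).trans (mul_le_of_le_one_right' (totalDegree_dehomogenize_X_le i j))
      refine (totalDegree_add _ _).trans (max_le ?_ ?_) <;> refine (totalDegree_mul _ _).trans ?_
      · exact add_le_add hN (h _)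
      · exact (add_le_add hN' (h _)).trans_eq (add_comm _ _)
    · simp only [map_add, map_mul, map_pow, ← hH, ← hH']
      ring
  | mul_X p k hp =>
    obtain ⟨N, H, hN, hH⟩ := hp
    refine ⟨N + 1, H * dehomogenize A i (X (j.succAbove k)), ?_, ?_⟩
    · exact (totalDegree_mul _ _).trans (add_le_add hN (totalDegree_dehomogenize_X_le _ _))
    · have := hX (j.succAbove k)
      rw [dehomogenize_X_succAbove] at this
      rw [map_mul, map_mul, ← hH, ← this]
      ring

section rigidity

variable {a : K →+* A} {ε : A →+* B} {G : ProjectiveSpace A n ⟶ ProjectiveSpace K n}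

lemma exists_chart_comp_eq (hε : Function.Surjective ε) (hnil : RingHom.ker ε ≤ nilradical A)
    (hB : baseMap ε n ≫ G = baseMap ε n ≫ baseMap a n) (i : Fin (n + 1)) :
    ∃ γ : MvPolynomial (Fin n) K →+* MvPolynomial (Fin n) A,
      chart A i ≫ G = Spec.map (CommRingCat.ofHom γ) ≫ chart K i ∧
      (map ε).comp γ = (map ε).comp (map a) := by
  have hε' : Function.Surjective (map (σ := Fin n) ε) := map_surjective ε hε
  have hsurj : Function.Surjective (PrimeSpectrum.comap (map (σ := Fin n) ε)) := by
    rw [← Set.range_eq_univ, range_comap_of_surjective _ _ hε', PrimeSpectrum.zeroLocus_eq_univ_iff]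
    intro p hp
    refine MvPolynomial.isNilpotent_iff.mpr fun m ↦ hnil ?_
    have := congr(coeff m $hp)
    rwa [coeff_map] at this
  have key : Spec.map (CommRingCat.ofHom (map ε)) ≫ chart A i ≫ G =
      Spec.map (CommRingCat.ofHom ((map ε).comp (map a))) ≫ chart K i := by
    rw [← Category.assoc, ← chart_baseMap, Category.assoc, hB, ← Category.assoc, chart_baseMap,
      Category.assoc, chart_baseMap, CommRingCat.ofHom_comp, Spec.map_comp, Category.assoc]
  have hrange : Set.range (chart A i ≫ G) ⊆ Set.range (chart K i) := by
    rintro _ ⟨y, rfl⟩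
    obtain ⟨z, rfl⟩ := hsurj y
    refine ⟨Spec.map (CommRingCat.ofHom ((map ε).comp (map a))) z, ?_⟩
    have := congr($key z)
    exact this.symm
  refine ⟨(Spec.preimage (IsOpenImmersion.lift (chart K i) (chart A i ≫ G) hrange)).hom, ?_, ?_⟩
  · simp
  · have h : Spec.map (CommRingCat.ofHom ((map ε).comp (Spec.preimage
        (IsOpenImmersion.lift (chart K i) (chart A i ≫ G) hrange)).hom)) =
        Spec.map (CommRingCat.ofHom ((map ε).comp (map a))) := by
      rw [← cancel_mono (chart K i), ← key]
      simp
    exact congr(($(Spec.map_injective h)).hom)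

/-- An infinitesimal deformation of the identity of projective space which fixes a
projective frame is constant. -/
theorem eq_baseMap_of_frame (hε : Function.Surjective ε) (hnil : RingHom.ker ε ≤ nilradical A)
    (hK : G ≫ toSpec K n = toSpec A n ≫ Spec.map (CommRingCat.ofHom a))
    (hB : baseMap ε n ≫ G = baseMap ε n ≫ baseMap a n)
    {τ : Fin n → A} (hτ : ∀ i, IsUnit (τ i)) (hτ' : IsUnit (1 - ∑ i, τ i))
    (hpt : ∀ w : Fin n → A, (w = 0 ∨ (∃ k, w = Pi.single k 1) ∨ w = τ) →
      Spec.map (CommRingCat.ofHom (eval w)) ≫ chart A 0 ≫ G =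
        Spec.map (CommRingCat.ofHom (eval w)) ≫ chart A 0 ≫ baseMap a n) :
    G = baseMap a n := by
  choose γ hγ hγε using exists_chart_comp_eq hε hnil hB
  have hγC (i r) : γ i (C r) = C (a r) := by
    have h : Spec.map (CommRingCat.ofHom ((γ i).comp C)) =
        Spec.map (CommRingCat.ofHom ((C : A →+* MvPolynomial (Fin n) A).comp a)) := by
      have := congr($(hγ i) ≫ toSpec K n)
      rw [Category.assoc, Category.assoc, hK, chart_toSpec, ← Category.assoc, chart_toSpec] at this
      rw [CommRingCat.ofHom_comp, CommRingCat.ofHom_comp, Spec.map_comp, Spec.map_comp, this]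
    exact congr(($(Spec.map_injective h)).hom r)
  let T := Localization (nonZeroDivisors (MvPolynomial (Fin n) A))
  let ι := algebraMap (MvPolynomial (Fin n) A) T
  have hι : Function.Injective ι := IsLocalization.injective T le_rfl
  have hrel (j l : Fin (n + 1)) : ∃ N H, totalDegree H ≤ N ∧
      H * γ 0 (dehomogenize K 0 (X j)) =
        dehomogenize A 0 (X j) ^ N * γ 0 (dehomogenize K 0 (X l)) := by
    obtain ⟨χ, hχC, hχX, hχ⟩ := exists_transition (A := A) (T := T) 0 j
    obtain ⟨N, H, hN, hH⟩ := exists_mul_pow_eq hχC hχX (γ j (dehomogenize K j (X l)))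
    refine ⟨N, H, hN, hι ?_⟩
    have := congr($hχ ≫ G)
    rw [Category.assoc, Category.assoc, hγ, hγ, ← Category.assoc, ← Category.assoc,
      ← Spec.map_comp, ← Spec.map_comp, ← CommRingCat.ofHom_comp, ← CommRingCat.ofHom_comp,
      SpecMap_comp_chart, SpecMap_comp_chart] at this
    have h := proportional_of_point_eq this j l
    simp only [RingHom.comp_apply, dehomogenize_X_self, map_one, mul_one] at h
    rw [map_mul, map_mul, map_pow, ← hH]
    linear_combination ι (dehomogenize A 0 (X j)) ^ N * h
  have hdeh (L : Type u) [CommRing L] (k : Fin n) : dehomogenize L 0 (X k.succ) = X k :=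
    dehomogenize_X_succAbove 0 k
  have hev (w : Fin n → A) (hw : w = 0 ∨ (∃ k, w = Pi.single k 1) ∨ w = τ) (k) :
      eval w (γ 0 (X k)) = w k := by
    have := hpt w hw
    rw [hγ, chart_baseMap, ← Category.assoc, ← Category.assoc, cancel_mono, ← Spec.map_comp,
      ← Spec.map_comp, ← CommRingCat.ofHom_comp, ← CommRingCat.ofHom_comp] at this
    have := congr(($(Spec.map_injective this)).hom (X k))
    simpa using this
  have h0 : γ 0 = map a := by
    refine MvPolynomial.ringHom_ext (fun r ↦ by simp [hγC]) fun k ↦ ?_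
    rw [map_X]
    refine eq_X_of_frame (f := fun k ↦ γ 0 (X k)) (fun k m ↦ ?_) (fun k ↦ ?_) (fun k l ↦ ?_)
      hτ hτ' ?_ ?_ ?_ k
    · refine hnil ?_
      have := congr(coeff m ($(hγε 0) (X k)))
      simp only [RingHom.comp_apply, map_X, coeff_map] at this
      rw [RingHom.mem_ker, coeff_sub, map_sub, this, sub_eq_zero, ← coeff_map, map_X]
    · simpa [hdeh] using hrel k.succ 0
    · simpa [hdeh] using hrel k.succ l.succ
    · exact hev 0 (.inl rfl)
    · exact fun i k ↦ hev _ (.inr (.inl ⟨k, rfl⟩)) i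
    · exact hev τ (.inr (.inr rfl))
  refine hom_ext fun i ↦ ?_
  obtain ⟨χ, -, -, hχ⟩ := exists_transition (A := A) (T := T) i 0
  have h : Spec.map (CommRingCat.ofHom ι) ≫ chart A i ≫ G =
      Spec.map (CommRingCat.ofHom ι) ≫ chart A i ≫ baseMap a n := by
    rw [← Category.assoc, hχ, Category.assoc, hγ, h0, ← chart_baseMap, ← Category.assoc, ← hχ,
      Category.assoc]
  rw [hγ, chart_baseMap] at h ⊢
  rw [← Category.assoc, ← Category.assoc, cancel_mono, ← Spec.map_comp,
      ← Spec.map_comp, ← CommRingCat.ofHom_comp, ← CommRingCat.ofHom_comp] at h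
  congr 3
  exact (RingHom.cancel_left hι).mp congr(($(Spec.map_injective h)).hom)

end rigidity

end ProjectiveSpace

section

open TensorProduct

lemma RingHom.ker_lmul'_le_nilradical {K B : Type*} [Field K] [Field B] [Algebra K B]
    [IsPurelyInseparable K B] :
    RingHom.ker (Algebra.TensorProduct.lmul' K (S := B)) ≤ nilradical (B ⊗[K] B) := by
  change KaehlerDifferential.ideal K B ≤ _
  rw [← KaehlerDifferential.span_range_eq_ideal, Ideal.span_le]
  rintro _ ⟨b, rfl⟩
  obtain ⟨q, _⟩ := ExpChar.exists K
  obtain ⟨m, c, hc⟩ := IsPurelyInseparable.pow_mem K q b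
  have : ExpChar (B ⊗[K] B) q :=
    expChar_of_injective_algebraMap (FaithfulSMul.algebraMap_injective K (B ⊗[K] B)) q
  refine ⟨q ^ m, ?_⟩
  simp only [sub_pow_expChar_pow, Algebra.TensorProduct.tmul_pow, one_pow, ← hc,
    Algebra.algebraMap_eq_smul_one, TensorProduct.tmul_smul, TensorProduct.smul_tmul', sub_self]
  exact Submodule.zero_mem _

end

namespace AlgebraicGeometry

lemma surjective_flat_quasiCompact_SpecMap {K B : Type u} [Field K] [CommRing B] [Nontrivial B]
    (f : K →+* B) : (@Surjective ⊓ @Flat ⊓ @QuasiCompact : MorphismProperty Scheme.{u})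
      (Spec.map (CommRingCat.ofHom f)) := by
  refine ⟨⟨⟨fun x ↦ ?_⟩, ?_⟩, inferInstance⟩
  · obtain ⟨y⟩ : Nonempty (PrimeSpectrum B) := inferInstance
    have : Subsingleton (PrimeSpectrum K) := inferInstance
    exact ⟨y, this.elim _ _⟩
  · rw [Flat.SpecMap_iff]
    algebraize [f]
    exact inferInstanceAs (Module.Flat K B)

end AlgebraicGeometry

namespace ProjectiveSpace
open MvPolynomial TensorProduct

variable {K B : Type u} [Field K] [Field B] [Algebra K B] {n : ℕ} {P : Scheme.{u}}
  {sP : P ⟶ Spec (.of K)} {π : ProjectiveSpace B n ⟶ P}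

/-- A form of projective space over a purely inseparable extension is trivial if it
has a rational projective frame. -/
theorem exists_iso_of_frame [IsPurelyInseparable K B]
    (hπ : IsPullback π (toSpec B n) sP (Spec.map (CommRingCat.ofHom (algebraMap K B))))
    {τ : Fin n → K} (hτ : ∀ i, τ i ≠ 0) (hτ' : 1 - ∑ i, τ i ≠ 0)
    (hpt : ∀ w : Fin n → K, (w = 0 ∨ (∃ k, w = Pi.single k 1) ∨ w = τ) → ∃ p : Spec (.of K) ⟶ P,
      Spec.map (CommRingCat.ofHom (eval (algebraMap K B ∘ w))) ≫ chart B 0 ≫ π =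
        Spec.map (CommRingCat.ofHom (algebraMap K B)) ≫ p) :
    ∃ e : P ≅ ProjectiveSpace K n, e.hom ≫ toSpec K n = sP := by
  let A := B ⊗[K] B
  let ι₁ : B →+* A := Algebra.TensorProduct.includeLeftRingHom
  let ι₂ : B →+* A := (Algebra.TensorProduct.includeRight (R := K) (A := B) (B := B)).toRingHom
  let ε : A →+* B := (Algebra.TensorProduct.lmul' K (S := B)).toRingHom
  let b := algebraMap K B
  have hι : ι₂.comp b = ι₁.comp b := by
    ext x
    simp only [ι₂, b, AlgHom.toRingHom_eq_coe, AlgHom.comp_algebraMap]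
    rfl
  have hε₁ : ε.comp ι₁ = .id B := RingHom.ext fun x ↦
    (Algebra.TensorProduct.lmul'_apply_tmul (R := K) x 1).trans (mul_one x)
  have hε₂ : ε.comp ι₂ = .id B := RingHom.ext fun x ↦
    (Algebra.TensorProduct.lmul'_apply_tmul (R := K) 1 x).trans (one_mul x)
  have hA : IsPullback (Spec.map (CommRingCat.ofHom ι₁)) (Spec.map (CommRingCat.ofHom ι₂))
      (Spec.map (CommRingCat.ofHom b)) (Spec.map (CommRingCat.ofHom b)) :=
    isPullback_SpecMap_of_isPushout _ _ _ _ (CommRingCat.isPushout_tensorProduct K B B)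
  let ψ := baseMap b n
  let q₁ := baseMap ι₁ n
  let q₂ : ProjectiveSpace A n ⟶ ProjectiveSpace B n :=
    hπ.lift (q₁ ≫ π) (toSpec A n ≫ Spec.map (CommRingCat.ofHom ι₂)) (by
      rw [Category.assoc, hπ.w, ← Category.assoc, (isPullback_baseMap ι₁ n).w, Category.assoc,
        Category.assoc, hA.w])
  have hq₂ : q₂ ≫ π = q₁ ≫ π := hπ.lift_fst _ _ _
  have hq₂' : q₂ ≫ toSpec B n = toSpec A n ≫ Spec.map (CommRingCat.ofHom ι₂) := hπ.lift_snd _ _ _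
  have hεq₂ : baseMap ε n ≫ q₂ = 𝟙 _ := by
    refine hπ.hom_ext ?_ ?_
    · rw [Category.assoc, hq₂, ← Category.assoc, ← baseMap_comp, hε₁, baseMap_id]
    · rw [Category.assoc, hq₂', ← Category.assoc, (isPullback_baseMap ε n).w, Category.assoc,
        ← Spec.map_comp, ← CommRingCat.ofHom_comp, hε₂, Category.id_comp]
      exact (congr(_ ≫ $(Spec.map_id _))).trans (Category.comp_id _)
  have key : q₂ ≫ ψ = baseMap (ι₁.comp b) n := by
    refine eq_baseMap_of_frame (ε := ε) (τ := ι₁.comp b ∘ τ) (fun x ↦ ⟨ι₁ x, congr($hε₁ x)⟩)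
      RingHom.ker_lmul'_le_nilradical ?_ ?_ (fun i ↦ (Ne.isUnit (hτ i)).map _) ?_ ?_
    · rw [Category.assoc, (isPullback_baseMap b n).w, ← Category.assoc, hq₂', Category.assoc,
        ← Spec.map_comp, ← CommRingCat.ofHom_comp, hι]
    · rw [← Category.assoc, hεq₂, Category.id_comp, ← baseMap_comp, ← RingHom.comp_assoc, hε₁,
        RingHom.id_comp]
    · simpa using (Ne.isUnit hτ').map (ι₁.comp b)
    · have hw (w : Fin n → K) (hw : w = 0 ∨ (∃ k, w = Pi.single k 1) ∨ w = τ) :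
          Spec.map (CommRingCat.ofHom (eval (ι₁.comp b ∘ w))) ≫ chart A 0 ≫ q₂ ≫ ψ =
            Spec.map (CommRingCat.ofHom (eval (ι₁.comp b ∘ w))) ≫ chart A 0 ≫
              baseMap (ι₁.comp b) n := by
        obtain ⟨p, hp⟩ := hpt w hw
        have h1 : Spec.map (CommRingCat.ofHom (eval (ι₁.comp b ∘ w))) ≫ chart A 0 ≫ q₂ =
            Spec.map (CommRingCat.ofHom ι₂) ≫ Spec.map (CommRingCat.ofHom (eval (b ∘ w))) ≫
              chart B 0 := by
          have hC {L : Type u} [CommRing L] (w : Fin n → L) : (eval w).comp C = .id L :=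
            RingHom.ext fun x ↦ eval_C x
          refine hπ.hom_ext ?_ ?_
          · have h : (eval (ι₁.comp b ∘ w)).comp (map ι₁) = ι₁.comp (eval (b ∘ w)) := by
              ext <;> simp
            simp only [Category.assoc]
            rw [hp, hq₂, ← Category.assoc (chart A 0), chart_baseMap, ← Category.assoc,
              ← Category.assoc, ← Spec.map_comp, ← CommRingCat.ofHom_comp, h,
              CommRingCat.ofHom_comp, Spec.map_comp, Category.assoc, Category.assoc, hp,
              ← Category.assoc, ← Category.assoc, ← Spec.map_comp, ← Spec.map_comp,
              ← CommRingCat.ofHom_comp, ← CommRingCat.ofHom_comp, hι]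
          · simp only [Category.assoc]
            rw [hq₂', chart_toSpec, ← Category.assoc (chart A 0), chart_toSpec, ← Category.assoc,
              ← Spec.map_comp, ← Spec.map_comp, ← Spec.map_comp, ← CommRingCat.ofHom_comp,
              ← CommRingCat.ofHom_comp, ← CommRingCat.ofHom_comp, hC, hC]
            exact (congr(_ ≫ $(Spec.map_id _)).trans (Category.comp_id _)).symm
        have h2 : (eval (ι₁.comp b ∘ w)).comp (map (ι₁.comp b)) =
            ι₂.comp ((eval (b ∘ w)).comp (map b)) := by
          ext x
          · simpa using congr($hι x).symm
          · simpa using congr($hι (w x)).symm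
        have h3 := congr(Spec.map (CommRingCat.ofHom $h2) ≫ chart K 0)
        rw [← Category.assoc (chart A 0), ← Category.assoc (Spec.map _), h1]
        simp only [Category.assoc, ψ]
        rw [chart_baseMap, chart_baseMap]
        simpa only [CommRingCat.ofHom_comp, Spec.map_comp, Category.assoc] using h3.symm
      rintro w (rfl | ⟨k, rfl⟩ | rfl)
      · have : (0 : Fin n → A) = ι₁.comp b ∘ (0 : Fin n → K) := by
          ext
          simp
        rw [this]
        exact hw 0 (.inl rfl)
      · have : (Pi.single k 1 : Fin n → A) = ι₁.comp b ∘ Pi.single k 1 := by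
          ext
          simp [Pi.single_apply]
        rw [this]
        exact hw _ (.inr (.inl ⟨k, rfl⟩))
      · exact hw τ (.inr (.inr rfl))
  have hQ := surjective_flat_quasiCompact_SpecMap b
  have hQ' {X Y : Scheme.{u}} {f : X ⟶ Y} {g : X ⟶ Spec (.of B)} {s : Y ⟶ Spec (.of K)}
      (h : IsPullback f g s (Spec.map (CommRingCat.ofHom b))) :
      (@Surjective ⊓ @Flat ⊓ @QuasiCompact : MorphismProperty Scheme.{u}) f :=
    ⟨⟨MorphismProperty.of_isPullback (P := @Surjective) h.flip hQ.1.1,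
      MorphismProperty.of_isPullback (P := @Flat) h.flip hQ.1.2⟩,
      MorphismProperty.of_isPullback (P := @QuasiCompact) h.flip hQ.2⟩
  have hQψ := hQ' (isPullback_baseMap b n)
  have : Surjective π := (hQ' hπ).1.1
  have : Flat π := (hQ' hπ).1.2
  have : QuasiCompact π := (hQ' hπ).2
  let h : P ⟶ ProjectiveSpace K n := EffectiveEpi.desc π ψ fun {Z} g₁ g₂ hg ↦ by
    let l₀ : Z ⟶ Spec (.of A) := hA.lift (g₁ ≫ toSpec B n) (g₂ ≫ toSpec B n) (by
      rw [Category.assoc, ← hπ.w, Category.assoc, ← hπ.w, reassoc_of% hg])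
    let l : Z ⟶ ProjectiveSpace A n := (isPullback_baseMap ι₁ n).lift g₁ l₀ (hA.lift_fst _ _ _).symm
    have h₁ : l ≫ q₁ = g₁ := (isPullback_baseMap ι₁ n).lift_fst _ _ _
    have h₂ : l ≫ q₂ = g₂ := by
      refine hπ.hom_ext ?_ ?_
      · rw [Category.assoc, hq₂, ← Category.assoc, h₁, hg]
      · rw [Category.assoc, hq₂', ← Category.assoc, (isPullback_baseMap ι₁ n).lift_snd _ _ _,
          hA.lift_snd]
    rw [← h₁, ← h₂, Category.assoc, Category.assoc, key, baseMap_comp]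
  have hh : π ≫ h = ψ := EffectiveEpi.fac _ _ _
  have hhs : h ≫ toSpec K n = sP := by
    rw [← cancel_epi π, ← Category.assoc, hh, hπ.w, (isPullback_baseMap b n).w]
  have hpb : IsPullback π (𝟙 _) h ψ := by
    refine IsPullback.of_bot ?_ ?_ (isPullback_baseMap b n)
    · rw [hhs, Category.id_comp]
      exact hπ
    · rw [hh, Category.id_comp]
  have : IsIso h := MorphismProperty.of_isPullback_of_descendsAlong
    (P := MorphismProperty.isomorphisms Scheme.{u}) (Q := @Surjective ⊓ @Flat ⊓ @QuasiCompact)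
    hpb.flip hQψ (inferInstanceAs (IsIso (𝟙 _)))
  exact ⟨asIso h, hhs⟩

end ProjectiveSpace

lemma IsSepClosed.infinite (K : Type*) [Field K] [IsSepClosed K] : Infinite K := by
  by_contra h
  have : Finite K := not_infinite_iff_finite.mp h
  have : IsAlgClosed K := IsSepClosed.isAlgClosed_of_perfectField K
  exact h inferInstance

namespace AlgebraicGeometry

/-- The spectrum of a purely inseparable field extension is universally injective. -/
lemma universallyInjective_SpecMap_algebraMap (K B : Type u) [Field K] [Field B] [Algebra K B]
    [IsPurelyInseparable K B] :
    UniversallyInjective (Spec.map (CommRingCat.ofHom (algebraMap K B))) := by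
  refine ((tfae_universallyInjective _).out 0 1).mpr ?_
  intro L _ g₁ g₂ h
  obtain ⟨g₁, rfl⟩ := Spec.map_surjective g₁
  obtain ⟨g₂, rfl⟩ := Spec.map_surjective g₂
  simp only [← Spec.map_comp] at h
  congr 1
  ext1
  exact IsPurelyInseparable.injective_comp_algebraMap K B L congr($(Spec.map_injective h).hom)

/-- A base change of the spectrum of a purely inseparable field extension is an open map. -/
lemma isOpenMap_of_isPullback_SpecMap {K B : Type u} [Field K] [Field B] [Algebra K B]
    [IsPurelyInseparable K B] {X Y : Scheme.{u}} {f : X ⟶ Y} {g : X ⟶ Spec (.of B)}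
    {s : Y ⟶ Spec (.of K)}
    (h : IsPullback f g s (Spec.map (CommRingCat.ofHom (algebraMap K B)))) :
    IsOpenMap f ∧ Function.Injective f := by
  have h₁ : IsIntegralHom f := MorphismProperty.of_isPullback (P := @IsIntegralHom) h.flip
    (IsIntegralHom.SpecMap_iff.mpr (algebraMap_isIntegral_iff.mpr inferInstance))
  have h₂ : UniversallyInjective f := MorphismProperty.of_isPullback (P := @UniversallyInjective)
    h.flip (universallyInjective_SpecMap_algebraMap K B)
  have h₃ : Surjective f := MorphismProperty.of_isPullback (P := @Surjective) h.flip
    (surjective_flat_quasiCompact_SpecMap _).1.1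
  refine ⟨fun U hU ↦ ?_, f.injective⟩
  rw [← isClosed_compl_iff, ← Set.image_compl_eq ⟨f.injective, f.surjective⟩]
  exact f.isClosedMap _ hU.isClosed_compl

end AlgebraicGeometry

namespace ProjectiveSpace
open MvPolynomial

variable {n : ℕ}

instance smooth_toSpec (R : Type u) [CommRing R] : Smooth (toSpec R n) := by
  have : IsZariskiLocalAtSource (@Smooth : MorphismProperty Scheme.{u}) :=
    HasRingHomProperty.instIsZariskiLocalAtSource
  refine (IsZariskiLocalAtSource.iff_of_openCover (P := @Smooth)
    (affineOpenCover R n).openCover).mpr fun (i : Fin (n + 1)) ↦ ?_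
  change Smooth (chart R i ≫ toSpec R n)
  rw [chart_toSpec, HasRingHomProperty.Spec_iff (P := @Smooth)]
  exact (RingHom.smooth_algebraMap (R := R) (S := MvPolynomial (Fin n) R)).mpr
    { formallySmooth := inferInstance
      finitePresentation := .mvPolynomial_of_finitePresentation _ }

/-- Points of projective space over `B` which descend to the separably closed field `K`
are dense. -/
theorem exists_eval_ne_zero {K B : Type u} [Field K] [IsSepClosed K] [Field B] [Algebra K B]
    [IsPurelyInseparable K B] {P : Scheme.{u}} {sP : P ⟶ Spec (.of K)} {π : ProjectiveSpace B n ⟶ P}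
    (hπ : IsPullback π (toSpec B n) sP (Spec.map (CommRingCat.ofHom (algebraMap K B))))
    {f : MvPolynomial (Fin n) B} (hf : f ≠ 0) :
    ∃ a : Fin n → B, eval a f ≠ 0 ∧ ∃ p : Spec (.of K) ⟶ P,
      Spec.map (CommRingCat.ofHom (eval a)) ≫ chart B 0 ≫ π =
        Spec.map (CommRingCat.ofHom (algebraMap K B)) ≫ p := by
  have := IsSepClosed.infinite K
  let L := Localization.Away f
  have hL : IsOpenImmersion (Spec.map (CommRingCat.ofHom (algebraMap (MvPolynomial (Fin n) B) L))) :=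
    IsOpenImmersion.of_isLocalization f
  let j : Spec (.of L) ⟶ ProjectiveSpace B n :=
    Spec.map (CommRingCat.ofHom (algebraMap (MvPolynomial (Fin n) B) L)) ≫ chart B 0
  have : Nontrivial L := by
    rw [← not_subsingleton_iff_nontrivial, IsLocalization.subsingleton_iff (M := .powers f)]
    exact fun ⟨m, hm⟩ ↦ hf (eq_zero_of_pow_eq_zero hm)
  obtain ⟨y⟩ : Nonempty (PrimeSpectrum L) := inferInstance
  obtain ⟨hopen, hinj⟩ := isOpenMap_of_isPullback_SpecMap hπ
  let W : P.Opens := ⟨π '' Set.range j, hopen _ j.opensRange.isOpen⟩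
  have hW : π ⁻¹ᵁ W = j.opensRange := TopologicalSpace.Opens.ext (hinj.preimage_image _)
  have : Nonempty W := ⟨⟨π (j y), _, ⟨y, rfl⟩, rfl⟩⟩
  have hWpb := (isPullback_morphismRestrict π W).flip.paste_horiz hπ.flip
  have : Smooth (W.ι ≫ sP) := MorphismProperty.of_isPullback_of_descendsAlong
    (P := @Smooth) (Q := @Surjective ⊓ @Flat ⊓ @QuasiCompact) hWpb
    (surjective_flat_quasiCompact_SpecMap _) inferInstance
  obtain ⟨s, hs⟩ := Smooth.exists_section_of_isSepClosed (W.ι ≫ sP)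
  let t : Spec (.of B) ⟶ (π ⁻¹ᵁ W : Scheme.{u}) :=
    hWpb.lift (𝟙 _) (Spec.map (CommRingCat.ofHom (algebraMap K B)) ≫ s)
      (by rw [Category.assoc, hs, Category.comp_id, Category.id_comp])
  have ht₁ : t ≫ π ∣_ W = Spec.map (CommRingCat.ofHom (algebraMap K B)) ≫ s := hWpb.lift_snd _ _ _
  have ht₂ : t ≫ (π ⁻¹ᵁ W).ι ≫ toSpec B n = 𝟙 _ := hWpb.lift_fst _ _ _
  let r : Spec (.of B) ⟶ Spec (.of L) := IsOpenImmersion.lift j (t ≫ (π ⁻¹ᵁ W).ι) (by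
    rintro _ ⟨x, rfl⟩
    exact hW.le (t x).2)
  have hr : r ≫ j = t ≫ (π ⁻¹ᵁ W).ι := IsOpenImmersion.lift_fac _ _ _
  let φ : L →+* B := (Spec.preimage r).hom
  have hφ : Spec.map (CommRingCat.ofHom φ) = r := Spec.map_preimage r
  let ψ : MvPolynomial (Fin n) B →+* B := φ.comp (algebraMap _ L)
  have hψ : Spec.map (CommRingCat.ofHom ψ) ≫ chart B 0 = t ≫ (π ⁻¹ᵁ W).ι := by
    rw [← hr, ← hφ]
    exact (congr($(Spec.map_comp _ _) ≫ chart B 0)).trans (Category.assoc _ _ _)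
  have hψC : ψ.comp C = .id B := by
    have h := congr($hψ ≫ toSpec B n)
    rw [Category.assoc, Category.assoc, ht₂, chart_toSpec, ← Spec.map_comp,
      ← CommRingCat.ofHom_comp] at h
    exact congr($(Spec.map_injective (h.trans (Spec.map_id _).symm)).hom)
  have hψe : ψ = eval (fun i ↦ ψ (X i)) := by
    ext i
    · simpa using congr($hψC i)
    · simp
  refine ⟨fun i ↦ ψ (X i), ?_, s ≫ W.ι, ?_⟩
  · rw [← hψe]
    exact ((IsLocalization.Away.algebraMap_isUnit (S := L) f).map φ).ne_zero
  · rw [← hψe, ← Category.assoc, hψ, ← Category.assoc, ← ht₁, Category.assoc, Category.assoc,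
      morphismRestrict_ι]

end ProjectiveSpace

namespace AlgebraicGeometry.Proj
open HomogeneousLocalization

variable {A B : Type u} {σ τ : Type u} [CommRing A] [CommRing B] [SetLike σ A] [AddSubgroupClass σ A]
  [SetLike τ B] [AddSubgroupClass τ B] {𝒜 : ℕ → σ} {ℬ : ℕ → τ} [GradedRing 𝒜] [GradedRing ℬ]

lemma map_toSpecZero (f : 𝒜 →+*ᵍ ℬ) (hf) (f₀ : 𝒜 0 →+* ℬ 0) (h : ∀ a, (f₀ a : B) = f a) :
    map f hf ≫ toSpecZero 𝒜 = toSpecZero ℬ ≫ Spec.map (CommRingCat.ofHom f₀) := by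
  have key (i : ℕ) (hi : 0 < i) (s : A) (hs : s ∈ 𝒜 i) :
      awayι ℬ (f s) (f.2 hs) hi ≫ map f hf ≫ toSpecZero 𝒜 =
        awayι ℬ (f s) (f.2 hs) hi ≫ toSpecZero ℬ ≫ Spec.map (CommRingCat.ofHom f₀) := by
    rw [awayι_comp_map_assoc f hf hi s hs, awayι_toSpecZero, reassoc_of% awayι_toSpecZero,
      ← Spec.map_comp, ← Spec.map_comp, ← CommRingCat.ofHom_comp, ← CommRingCat.ofHom_comp]
    congr 2
    ext a
    change Localization.mk (f a) (⟨f 1, _⟩ : Submonoid.powers (f s)) =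
      Localization.mk (f₀ a : B) (⟨1, _⟩ : Submonoid.powers (f s))
    congr 1
    · exact (h a).symm
    · exact Subtype.ext (map_one f)
  exact (mapAffineOpenCover f hf).openCover.hom_ext _ _ fun s : (i : ℕ+) × 𝒜 i ↦
    key _ s.1.2 s.2 s.2.2

end AlgebraicGeometry.Proj

namespace ProjectiveSpace
open MvPolynomial

variable {R : Type u} [CommRing R] {n : ℕ}

lemma IsProjective.toHom_toSpec {g : MvPolynomial (Fin (n + 1)) R →+* MvPolynomial (Fin (n + 1)) R}
    (hg : IsProjective g) (hC : g.comp C = C) : hg.toHom ≫ toSpec R n = toSpec R n := by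
  let f₀ : homogeneousSubmodule (Fin (n + 1)) R 0 →+* homogeneousSubmodule (Fin (n + 1)) R 0 :=
    (g.comp (SetLike.GradeZero.subring (homogeneousSubmodule (Fin (n + 1)) R)).subtype).codRestrict
      (SetLike.GradeZero.subring (homogeneousSubmodule (Fin (n + 1)) R))
      fun x ↦ hg.isHomogeneous x.2
  have h := Proj.map_toSpecZero hg.gradedRingHom hg.irrelevant_le f₀ fun _ ↦ rfl
  refine (Category.assoc _ _ _).symm.trans ((congr($h ≫ Spec.map (CommRingCat.ofHom
    (algebraMap R (homogeneousSubmodule (Fin (n + 1)) R 0))))).trans ((Category.assoc _ _ _).trans ?_))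
  rw [← Spec.map_comp, ← CommRingCat.ofHom_comp]
  have : f₀.comp (algebraMap R (homogeneousSubmodule (Fin (n + 1)) R 0)) = algebraMap R _ :=
    RingHom.ext fun r ↦ Subtype.ext congr($hC r)
  rw [this]
  rfl

variable {M N : Matrix (Fin (n + 1)) (Fin (n + 1)) R}

lemma bind₁_toMvPolynomial_comp (h : M * N = 1) :
    (bind₁ N.toMvPolynomial).toRingHom.comp (bind₁ M.toMvPolynomial).toRingHom = .id _ := by
  ext i : 2
  · simp
  · simp [← Matrix.toMvPolynomial_mul, h]

lemma isProjective_bind₁ (h : N * M = 1) : IsProjective (bind₁ M.toMvPolynomial).toRingHom where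
  isHomogeneous {d p} hp := by
    simpa using hp.aeval M.toMvPolynomial fun i ↦ M.toMvPolynomial_isHomogeneous i
  X_mem_span j := by
    rw [← congr_fun (Matrix.toMvPolynomial_one (R := R)) j, ← h, Matrix.toMvPolynomial_mul,
      Matrix.toMvPolynomial, map_sum]
    refine Ideal.sum_mem _ fun i _ ↦ ?_
    rw [← C_mul_X_eq_monomial, map_mul]
    exact Ideal.mul_mem_left _ _ (Ideal.subset_span ⟨i, rfl⟩)

/-- Projective linear changes of coordinates. -/
theorem exists_iso_of_mul_eq_one (h : N * M = 1) : ∃ e : ProjectiveSpace R n ≅ ProjectiveSpace R n,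
    e.hom ≫ toSpec R n = toSpec R n ∧ ∀ (a b : Fin n → R) (u : R), IsUnit u →
      M.mulVec (Fin.cons 1 a) = u • Fin.cons 1 b →
      Spec.map (CommRingCat.ofHom (eval a)) ≫ chart R 0 ≫ e.hom =
        Spec.map (CommRingCat.ofHom (eval b)) ≫ chart R 0 := by
  have h' := mul_eq_one_comm.mp h
  let g := isProjective_bind₁ h
  let g' := isProjective_bind₁ h'
  refine ⟨⟨g.toHom, g'.toHom, ?_, ?_⟩, g.toHom_toSpec ?_, fun a b u hu hab ↦ ?_⟩
  · rw [← IsProjective.toHom_comp, ← IsProjective.toHom_id]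
    exact IsProjective.toHom_congr _ (bind₁_toMvPolynomial_comp h)
  · rw [← IsProjective.toHom_comp, ← IsProjective.toHom_id]
    exact IsProjective.toHom_congr _ (bind₁_toMvPolynomial_comp h')
  · ext : 1
    simp
  have hX (a : Fin n → R) (j) : eval a (dehomogenize R 0 (X j)) = (Fin.cons 1 a : Fin (n + 1) → R) j := by
    induction j using Fin.cases with
    | zero => simp
    | succ k => simpa using congr(eval a $(dehomogenize_X_succAbove 0 k))
  have he : (eval a).comp (dehomogenize R 0) = eval (Fin.cons 1 a) := by
    ext j
    · simp
    · simpa using hX a j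
  have hX' (j) : (((eval a).comp (dehomogenize R 0)).comp (bind₁ M.toMvPolynomial).toRingHom) (X j) =
      u * ((eval b).comp (dehomogenize R 0)) (X j) := by
    rw [RingHom.comp_apply, he, RingHom.comp_apply, hX, ← smul_eq_mul, ← Pi.smul_apply, ← hab]
    simpa using Matrix.toMvPolynomial_eval_eq_apply M j _
  rw [← Category.assoc, SpecMap_comp_chart, SpecMap_comp_chart,
    g.point_toHom _ 0 0 _ (show IsUnit ((((eval a).comp (dehomogenize R 0)).comp
      (bind₁ M.toMvPolynomial).toRingHom) (X 0)) by rw [hX' 0]; simpa using hu)]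
  exact point_eq_of_scale u (fun r ↦ by simp) hX' _ _ _

end ProjectiveSpace

namespace MvPolynomial

variable {B : Type u} [Field B] {n : ℕ}

/-- The dehomogenization of a linear form. -/
lemma exists_eval_eq_apply_cons (l : (Fin (n + 1) → B) →ₗ[B] B) (hl : l ≠ 0) :
    ∃ f : MvPolynomial (Fin n) B, f ≠ 0 ∧ ∀ a : Fin n → B, eval a f = l (Fin.cons 1 a) := by
  have h (a : Fin n → B) : eval a (C (l (Pi.single 0 1)) +
      ∑ i : Fin n, C (l (Pi.single i.succ 1)) * X i) = l (Fin.cons 1 a) := by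
    rw [← Finset.univ_sum_single (Fin.cons 1 a : Fin (n + 1) → B), map_sum, Fin.sum_univ_succ]
    simp only [map_add, eval_C, map_sum, map_mul, eval_X, Fin.cons_zero, Fin.cons_succ]
    congr 1
    refine Finset.sum_congr rfl fun i _ ↦ ?_
    rw [mul_comm, ← smul_eq_mul, ← map_smul, ← Pi.single_smul, smul_eq_mul, mul_one]
  refine ⟨_, fun h0 ↦ hl ?_, h⟩
  simp only [h0, map_zero] at h
  have h₀ : l (Pi.single 0 1) = 0 := by
    rw [h 0]
    congr 1
    ext i
    induction i using Fin.cases <;> simp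
  refine LinearMap.pi_ext' fun i ↦ LinearMap.ext_ring ?_
  induction i using Fin.cases with
  | zero => simpa using h₀
  | succ k =>
    have : (Fin.cons 1 (Pi.single k 1) : Fin (n + 1) → B) = Pi.single 0 1 + Pi.single k.succ 1 := by
      ext i
      induction i using Fin.cases <;> simp [Pi.single_apply]
    simpa [this, h₀, eq_comm] using h (Pi.single k 1)

variable {S : Set (Fin n → B)}
lemma exists_basis_of_dense (hS : ∀ f : MvPolynomial (Fin n) B, f ≠ 0 → ∃ a ∈ S, eval a f ≠ 0) :
    ∃ v : Module.Basis (Fin (n + 1)) B (Fin (n + 1) → B), ∀ i, ∃ a ∈ S, v i = Fin.cons 1 a := by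
  let T : Set (Fin (n + 1) → B) := (fun a ↦ Fin.cons 1 a) '' S
  have hT : ⊤ ≤ Submodule.span B T := by
    by_contra hlt
    obtain ⟨l, hl, hle⟩ := Submodule.exists_le_ker_of_lt_top _ (lt_top_iff_ne_top.mpr fun h ↦ hlt h.ge)
    obtain ⟨f, hf, hfl⟩ := exists_eval_eq_apply_cons l hl
    obtain ⟨a, ha, haf⟩ := hS f hf
    exact haf ((hfl a).trans (hle (Submodule.subset_span ⟨a, ha, rfl⟩)))
  let b := Module.Basis.ofSpan hT
  refine ⟨b.reindex (b.indexEquiv (Pi.basisFun B (Fin (n + 1)))), fun i ↦ ?_⟩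
  obtain ⟨a, ha, h⟩ := Module.Basis.ofSpan_subset hT
    ⟨(b.indexEquiv (Pi.basisFun B (Fin (n + 1)))).symm i, rfl⟩
  exact ⟨a, ha, (b.reindex_apply _ i).trans h.symm⟩

lemma exists_matrix_of_dense (hS : ∀ f : MvPolynomial (Fin n) B, f ≠ 0 → ∃ a ∈ S, eval a f ≠ 0)
    {τ : Fin n → B} (hτ : ∀ i, τ i ≠ 0) (hτ' : 1 - ∑ i, τ i ≠ 0) :
    ∃ M N : Matrix (Fin (n + 1)) (Fin (n + 1)) B, N * M = 1 ∧
      ∀ w : Fin n → B, (w = 0 ∨ (∃ k, w = Pi.single k 1) ∨ w = τ) →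
        ∃ a ∈ S, ∃ u : B, u ≠ 0 ∧ M.mulVec (Fin.cons 1 w) = u • Fin.cons 1 a := by
  obtain ⟨v, hv⟩ := exists_basis_of_dense hS
  choose g hg hgl using fun i ↦ exists_eval_eq_apply_cons (v.coord i)
    fun h ↦ one_ne_zero (α := B) (by simpa using congr($h (v i)))
  obtain ⟨a', ha', hga'⟩ := hS (∏ i, g i) (Finset.prod_ne_zero_iff.mpr fun i _ ↦ hg i)
  let c (i) := v.repr (Fin.cons 1 a') i
  have hc (i) : c i ≠ 0 := by
    rw [map_prod] at hga'
    have := Finset.prod_ne_zero_iff.mp hga' i (Finset.mem_univ i)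
    rwa [hgl] at this
  let d : Fin (n + 1) → B := Fin.cons (1 - ∑ i, τ i) τ
  have hd (i) : d i ≠ 0 := by
    induction i using Fin.cases with
    | zero => exact hτ'
    | succ k => exact hτ k
  let y (i) : Fin (n + 1) → B := (c i / d i) • v i
  let L : (Fin (n + 1) → B) →ₗ[B] (Fin (n + 1) → B) := (Pi.basisFun B (Fin (n + 1))).constr B
    (Fin.cons (y 0) fun k ↦ y k.succ - y 0 : Fin (n + 1) → Fin (n + 1) → B)
  have hL₀ : L (Pi.single 0 1) = y 0 := by
    rw [← Pi.basisFun_apply]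
    exact (Pi.basisFun B (Fin (n + 1))).constr_basis B _ _
  have hL₁ (k : Fin n) : L (Pi.single k.succ 1) = y k.succ - y 0 := by
    rw [← Pi.basisFun_apply]
    exact (Pi.basisFun B (Fin (n + 1))).constr_basis B _ _
  have hy (i) : y i ∈ L.range := by
    have h0 : y 0 ∈ L.range := ⟨_, hL₀⟩
    induction i using Fin.cases with
    | zero => exact h0
    | succ k => simpa using add_mem (⟨_, hL₁ k⟩ : y k.succ - y 0 ∈ L.range) h0
  have hsurj : L.range = ⊤ := by
    rw [eq_top_iff, ← v.span_eq, Submodule.span_le]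
    rintro _ ⟨i, rfl⟩
    simpa [y, smul_smul, hc i, hd i] using L.range.smul_mem (c i / d i)⁻¹ (hy i)
  obtain ⟨L', hL'⟩ := L.exists_rightInverse_of_surjective hsurj
  refine ⟨LinearMap.toMatrix' L, LinearMap.toMatrix' L', mul_eq_one_comm.mp ?_, ?_⟩
  · rw [← LinearMap.toMatrix'_comp, hL', LinearMap.toMatrix'_id]
  have hcons (w : Fin n → B) : (Fin.cons 1 w : Fin (n + 1) → B) =
      Pi.single 0 1 + ∑ i, w i • Pi.single i.succ 1 := by
    rw [← Finset.univ_sum_single (Fin.cons 1 w : Fin (n + 1) → B), Fin.sum_univ_succ]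
    simp [← Pi.single_smul]
  have hLw (w : Fin n → B) : (LinearMap.toMatrix' L).mulVec (Fin.cons 1 w) =
      (1 - ∑ i, w i) • y 0 + ∑ i, w i • y i.succ := by
    rw [LinearMap.toMatrix'_mulVec, hcons]
    simp [hL₀, hL₁, smul_sub, sub_smul, Finset.sum_smul]
    abel
  have hy' (i) : ∃ a ∈ S, ∃ u : B, u ≠ 0 ∧ y i = u • Fin.cons 1 a := by
    obtain ⟨a, ha, h⟩ := hv i
    exact ⟨a, ha, _, div_ne_zero (hc i) (hd i), by rw [← h]⟩
  rintro w (rfl | ⟨k, rfl⟩ | rfl)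
  · simpa [hLw] using hy' 0
  · simpa [hLw, Pi.single_apply, ite_smul] using hy' k.succ
  · refine ⟨a', ha', 1, one_ne_zero, ?_⟩
    rw [hLw, one_smul, ← v.sum_repr (Fin.cons 1 a'), Fin.sum_univ_succ]
    have hdy (i) : d i • y i = v.repr (Fin.cons 1 a') i • v i := by
      simp [y, c, smul_smul, mul_div_cancel₀ _ (hd i)]
    rw [← hdy 0]
    congr 1
    exact Finset.sum_congr rfl fun i _ ↦ hdy i.succ

end MvPolynomial

namespace ProjectiveSpace
open MvPolynomial

variable {n : ℕ} {K B : Type u} [Field K] [IsSepClosed K] [Field B] [Algebra K B]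
  [IsPurelyInseparable K B] {P : Scheme.{u}} {sP : P ⟶ Spec (.of K)} {π : ProjectiveSpace B n ⟶ P}

/-- A form of projective space that is split by a purely inseparable extension of a separably
closed field is split. -/
theorem exists_iso_of_isPurelyInseparable
    (hπ : IsPullback π (toSpec B n) sP (Spec.map (CommRingCat.ofHom (algebraMap K B)))) :
    ∃ e : P ≅ ProjectiveSpace K n, e.hom ≫ toSpec K n = sP := by
  have := IsSepClosed.infinite K
  obtain ⟨t, ht⟩ := ((Set.finite_singleton (n : K)⁻¹).insert 0).exists_notMem
  simp only [Set.mem_insert_iff, Set.mem_singleton_iff, not_or] at ht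
  have htn : 1 - ∑ _i : Fin n, t ≠ 0 := by
    rw [sub_ne_zero, Finset.sum_const, Finset.card_univ, Fintype.card_fin, nsmul_eq_mul]
    exact fun h ↦ ht.2 (eq_inv_of_mul_eq_one_right h.symm)
  obtain ⟨M, N, hNM, hM⟩ := exists_matrix_of_dense
    (S := {a : Fin n → B | ∃ p : Spec (.of K) ⟶ P, Spec.map (CommRingCat.ofHom (eval a)) ≫
      chart B 0 ≫ π = Spec.map (CommRingCat.ofHom (algebraMap K B)) ≫ p})
    (fun f hf ↦ by
      obtain ⟨a, ha, hp⟩ := exists_eval_ne_zero hπ hf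
      exact ⟨a, hp, ha⟩)
    (τ := fun _ ↦ algebraMap K B t) (fun _ ↦ by simpa using ht.1)
    (by simpa using (map_ne_zero (algebraMap K B)).mpr htn)
  obtain ⟨e, he, hea⟩ := exists_iso_of_mul_eq_one hNM
  have hπ' : IsPullback (e.hom ≫ π) (toSpec B n) sP
      (Spec.map (CommRingCat.ofHom (algebraMap K B))) :=
    hπ.of_iso e.symm (.refl _) (.refl _) (.refl _) (by simp)
      (by rw [Iso.refl_hom, Category.comp_id, Iso.symm_hom, Iso.eq_inv_comp]; exact he)
      (by simp) (by simp)
  refine exists_iso_of_frame hπ' (τ := fun _ ↦ t) (fun _ ↦ ht.1) htn fun w hw ↦ ?_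
  obtain ⟨a, ⟨p, hp⟩, u, hu, huw⟩ := hM (algebraMap K B ∘ w) (by
    rcases hw with rfl | ⟨k, rfl⟩ | rfl
    · exact .inl (funext fun _ ↦ map_zero _)
    · refine .inr (.inl ⟨k, funext fun i ↦ ?_⟩)
      simp [Pi.single_apply, apply_ite (algebraMap K B)]
    · exact .inr (.inr rfl))
  refine ⟨p, Eq.trans ?_ hp⟩
  simpa using congr($(hea _ a u hu.isUnit huw) ≫ π)

end ProjectiveSpace

lemma schemeBaseChange.exists_isPullback {k K B : Type u} [CommRing k] [CommRing K] [CommRing B]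
    (f : k →+* K) (g : K →+* B) (h : k →+* B) (hfg : g.comp f = h)
    {X : Scheme.{u}} (sX : X ⟶ Spec (CommRingCat.of k)) :
    ∃ π : schemeBaseChange h sX ⟶ schemeBaseChange f sX,
      IsPullback π (toSpec h sX) (toSpec f sX) (Spec.map (CommRingCat.ofHom g)) := by
  subst hfg
  have hp : IsPullback (pullback.fst sX (Spec.map (CommRingCat.ofHom (g.comp f)))) (pullback.snd _ _)
      sX (Spec.map (CommRingCat.ofHom g) ≫ Spec.map (CommRingCat.ofHom f)) := by
    rw [← Spec.map_comp, ← CommRingCat.ofHom_comp]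
    exact .of_hasPullback _ _
  exact ⟨_, .of_right' hp (.of_hasPullback sX (Spec.map (CommRingCat.ofHom f)))⟩

/-- In positive characteristic, a Severi–Brauer variety becomes trivial over
the separable closure `k^s ⊆ k̄` of `k`. -/
theorem severiBrauer_trivial_over_separable_closure {k : Type u} [Field k]
    (p : ℕ) (hp : 0 < p) [CharP k p]
    {P : Scheme.{u}} (sP : P ⟶ Spec (CommRingCat.of k)) (n : ℕ) (hSB : IsSeveriBrauer sP n) :
    ∃ e : schemeBaseChange
        (algebraMap k (separableClosure k (AlgebraicClosure k))) sP ≅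
        ProjectiveSpace (separableClosure k (AlgebraicClosure k)) n,
      e.hom ≫ ProjectiveSpace.toSpec (separableClosure k (AlgebraicClosure k)) n =
        schemeBaseChange.toSpec
          (algebraMap k (separableClosure k (AlgebraicClosure k))) sP := by
  obtain ⟨e, he⟩ := hSB.exists_iso
  obtain ⟨π, hπ⟩ := schemeBaseChange.exists_isPullback
    (algebraMap k (separableClosure k (AlgebraicClosure k)))
    (algebraMap (separableClosure k (AlgebraicClosure k)) (AlgebraicClosure k)) _
    (IsScalarTower.algebraMap_eq k _ (AlgebraicClosure k)).symm sP
  have : IsSepClosed (separableClosure k (AlgebraicClosure k)) :=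
    (separableClosure.isSepClosure k (AlgebraicClosure k)).sep_closed
  exact ProjectiveSpace.exists_iso_of_isPurelyInseparable (π := e.inv ≫ π)
    (hπ.of_iso e (.refl _) (.refl _) (.refl _) (by simp) (by simp [he]) (by simp) (by simp))
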